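/- arXiv:0905.1885 — 4 statements merged into one kernel-verified Lean document; each statement's English description precedes it below -/
import Mathlib

section
/- Let G be a finite abelian group. Then the characteristic subgroups of G are totally ordered by inclusion (i.e., for any two characteristic subgroups H, K of G, either H ⊆ K or K ⊆ H) if and only if G is isomorphic to (Z_{p^k})^{μ_1} × (Z_{p^{k+1}})^{μ_2} for some prime p and natural numbers k, μ_1, μ_2 ≥ 0. -/
/-- A subgroup is characteristic if it is mapped onto itself by every automorphism. -/
def IsCharSub {G : Type*} [AddGroup G] (H : AddSubgroup G) : Prop :=
  ∀ φ : AddAut G, AddSubgroup.map φ.toAddMonoidHom H = H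

/-- A characteristic subgroup is stable under every square-zero endomorphism `f`, since `1 + f` is
an automorphism. -/
theorem IsCharSub.map_mem_of_comp_self_eq_zero {G : Type*} [AddCommGroup G] {H : AddSubgroup G}
    (hH : IsCharSub H) (f : G →+ G) (hf : ∀ x, f (f x) = 0) {x : G} (hx : x ∈ H) : f x ∈ H := by
  let φ : AddAut G :=
    { toFun := fun x => x + f x
      invFun := fun x => x - f x
      left_inv := fun x => by simp [hf]
      right_inv := fun x => by simp [hf]
      map_add' := fun x y => by simp only [map_add]; abel }
  have h : x + f x ∈ AddSubgroup.map φ.toAddMonoidHom H := ⟨x, hx, rfl⟩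
  rw [hH φ] at h
  simpa using H.sub_mem h hx

/-- The elements of `G` killed by `n` form a characteristic subgroup. -/
theorem isCharSub_ker_nsmul (G : Type*) [AddCommGroup G] (n : ℕ) :
    IsCharSub (nsmulAddMonoidHom (α := G) n).ker := by
  intro φ
  ext x
  constructor
  · rintro ⟨y, hy, rfl⟩
    have hy' : n • y = 0 := hy
    change n • φ y = 0
    rw [← map_nsmul, hy', map_zero]
  · intro hx
    have hx' : n • x = 0 := hx
    refine ⟨φ.symm x, ?_, φ.apply_symm_apply x⟩
    change n • φ.symm x = 0
    rw [← map_nsmul, hx', map_zero]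

/-- The multiples of `n` in `G` form a characteristic subgroup. -/
theorem isCharSub_range_nsmul (G : Type*) [AddCommGroup G] (n : ℕ) :
    IsCharSub (nsmulAddMonoidHom (α := G) n).range := by
  intro φ
  ext x
  constructor
  · rintro ⟨_, ⟨y, rfl⟩, rfl⟩
    exact ⟨φ y, (map_nsmul φ n y).symm⟩
  · rintro ⟨y, rfl⟩
    refine ⟨n • φ.symm y, ⟨φ.symm y, rfl⟩, ?_⟩
    change φ (n • φ.symm y) = n • y
    rw [map_nsmul]
    exact congrArg (n • ·) (φ.apply_symm_apply y)

section Pi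

variable {ι : Type*} [Fintype ι] [DecidableEq ι] {A : ι → Type*} [∀ i, AddCommGroup (A i)]

/-- If some coordinate `x i` of `x ∈ S` can be mapped to every coordinate of `x` and of `y`, then
`y ∈ S`, provided `S` is stable under homomorphisms between distinct coordinates. -/
theorem mem_of_forall_exists_hom [∀ i, IsAddCyclic (A i)] {S : AddSubgroup (∀ i, A i)}
    (hS : ∀ i j, i ≠ j → ∀ f : A i →+ A j, ∀ x ∈ S, Pi.single j (f (x i)) ∈ S)
    {x y : ∀ i, A i} (hx : x ∈ S) (i : ι) (hxx : ∀ j, ∃ f : A i →+ A j, f (x i) = x j)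
    (hxy : ∀ j, ∃ f : A i →+ A j, f (x i) = y j) : y ∈ S := by
  have hi : Pi.single i (x i) ∈ S := by
    have h := Finset.add_sum_erase Finset.univ (fun j => Pi.single j (x j)) (Finset.mem_univ i)
    rw [Finset.univ_sum_single] at h
    rw [eq_sub_of_add_eq h]
    refine S.sub_mem hx (S.sum_mem fun j hj => ?_)
    obtain ⟨f, hf⟩ := hxx j
    rw [← hf]
    exact hS i j (Finset.ne_of_mem_erase hj).symm f x hx
  rw [← Finset.univ_sum_single y]
  refine S.sum_mem fun j _ => ?_
  obtain ⟨f, hf⟩ := hxy j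
  rw [← hf]
  obtain rfl | hij := eq_or_ne i j
  · obtain ⟨m, hm⟩ := f.map_addCyclic
    rw [hm, Pi.single_zsmul]
    exact S.zsmul_mem hi m
  · exact hS i j hij f x hx

/-- The characteristic subgroups of a product of cyclic groups form a chain if any two elements of
the factors are comparable under homomorphisms between the factors. -/
theorem isCharSub_le_total_of_addEquiv_pi [∀ i, IsAddCyclic (A i)]
    (hA : ∀ i j (a : A i) (b : A j), (∃ f : A i →+ A j, f a = b) ∨ ∃ f : A j →+ A i, f b = a)
    {G : Type*} [AddCommGroup G] (e : G ≃+ ∀ i, A i) {H K : AddSubgroup G}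
    (hH : IsCharSub H) (hK : IsCharSub K) : H ≤ K ∨ K ≤ H := by
  have stable {L : AddSubgroup G} (hL : IsCharSub L) (i j : ι) (hij : i ≠ j) (f : A i →+ A j)
      (x) (hx : x ∈ L.comap e.symm.toAddMonoidHom) :
      Pi.single j (f (x i)) ∈ L.comap e.symm.toAddMonoidHom := by
    let F : G →+ G := e.symm.toAddMonoidHom.comp
      (((AddMonoidHom.single A j).comp (f.comp (Pi.evalAddMonoidHom A i))).comp e.toAddMonoidHom)
    have hF (z : G) : F z = e.symm (Pi.single j (f (e z i))) := rfl
    have h := hL.map_mem_of_comp_self_eq_zero F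
      (fun z => by simp [hF, Pi.single_eq_of_ne hij]) (x := e.symm x) hx
    rw [hF, e.apply_symm_apply] at h
    exact h
  let r : (Σ i, A i) → (Σ i, A i) → Prop := fun a b => ∃ f : A b.1 →+ A a.1, f b.2 = a.2
  have : IsTrans _ r := ⟨by
    rintro a b c ⟨f, hf⟩ ⟨g, hg⟩
    exact ⟨f.comp g, by simp [hf, hg]⟩⟩
  have hid (a : Σ i, A i) : r a a := ⟨AddMonoidHom.id _, rfl⟩
  have key (x : ∀ i, A i) [Nonempty ι] : ∃ i, ∀ j, r ⟨j, x j⟩ ⟨i, x i⟩ := by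
    refine Directed.finite_le (r := r) (f := fun i => ⟨i, x i⟩) (fun i j => ?_) id
    rcases hA i j (x i) (x j) with h | h
    · exact ⟨i, hid _, h⟩
    · exact ⟨j, h, hid _⟩
  by_contra! hne
  obtain ⟨⟨x, hx, hxK⟩, ⟨y, hy, hyH⟩⟩ :=
    And.intro (SetLike.not_le_iff_exists.mp hne.1) (SetLike.not_le_iff_exists.mp hne.2)
  have : Nonempty ι := by
    by_contra hι
    rw [not_nonempty_iff] at hι
    exact hxK (e.injective (Subsingleton.elim (e 0) (e x)) ▸ K.zero_mem)
  obtain ⟨i, hi⟩ := key (e x)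
  obtain ⟨j, hj⟩ := key (e y)
  rcases hA i j (e x i) (e y j) with h | h
  · have := mem_of_forall_exists_hom (stable hH) (x := e x) (y := e y) (by simpa using hx) i hi
      fun l => _root_.trans (hj l) (show r ⟨j, e y j⟩ ⟨i, e x i⟩ from h)
    exact hyH (by simpa using this)
  · have := mem_of_forall_exists_hom (stable hK) (x := e y) (y := e x) (by simpa using hy) j hj
      fun l => _root_.trans (hi l) (show r ⟨i, e x i⟩ ⟨j, e y j⟩ from h)
    exact hxK (by simpa using this)

end Pi

/-- A homomorphism `ℤ/n → ℤ/m` is given by the image `c` of `1`, subject to `n * c = 0`. -/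
theorem ZMod.exists_hom_apply_natCast {n m : ℕ} {c : ZMod m} (hc : (n : ZMod m) * c = 0) :
    ∃ f : ZMod n →+ ZMod m, ∀ a : ℕ, f (a : ZMod n) = a * c := by
  refine ⟨ZMod.lift n ⟨zmultiplesHom (ZMod m) c, by simpa using hc⟩, fun a => ?_⟩
  have h := ZMod.lift_coe n ⟨zmultiplesHom (ZMod m) c, by simpa using hc⟩ (a : ℤ)
  simpa using h

theorem ZMod.exists_hom_of_le {p : ℕ} (hp : p.Prime) {e f u v s t : ℕ} (hs : ¬ p ∣ s)
    (huv : u ≤ v) (hfe : f + u ≤ e + v) :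
    ∃ g : ZMod (p ^ e) →+ ZMod (p ^ f), g ((p ^ u * s : ℕ)) = ((p ^ v * t : ℕ)) := by
  have hs' : s.Coprime (p ^ f) := (((Nat.Prime.coprime_iff_not_dvd hp).2 hs).symm).pow_right f
  have hinv := ZMod.coe_mul_inv_eq_one s hs'
  have hz : (p : ZMod (p ^ f)) ^ (e + (v - u)) = 0 := by
    have h0 : (p : ZMod (p ^ f)) ^ f = 0 := by exact_mod_cast ZMod.natCast_self (p ^ f)
    exact pow_eq_zero_of_le (by omega) h0
  obtain ⟨g, hg⟩ := ZMod.exists_hom_apply_natCast (n := p ^ e) (m := p ^ f)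
    (c := (p : ZMod (p ^ f)) ^ (v - u) * t * (s : ZMod (p ^ f))⁻¹)
    (by
      push_cast
      rw [← mul_assoc, ← mul_assoc, ← pow_add, hz]
      simp)
  refine ⟨g, ?_⟩
  rw [hg]
  push_cast
  have hpow : (p : ZMod (p ^ f)) ^ v = p ^ u * p ^ (v - u) := by
    rw [← pow_add, Nat.add_sub_cancel' huv]
  rw [hpow]
  linear_combination (p : ZMod (p ^ f)) ^ u * p ^ (v - u) * t * hinv

/-- Elements of `ℤ/p^e` and `ℤ/p^f` with `|e - f| ≤ 1` are comparable under homomorphisms. -/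
theorem ZMod.exists_hom_total {p : ℕ} (hp : p.Prime) {e f : ℕ} (hef : e ≤ f + 1) (hfe : f ≤ e + 1)
    (a : ZMod (p ^ e)) (b : ZMod (p ^ f)) :
    (∃ g : ZMod (p ^ e) →+ ZMod (p ^ f), g a = b) ∨
      ∃ g : ZMod (p ^ f) →+ ZMod (p ^ e), g b = a := by
  have : NeZero p := ⟨hp.ne_zero⟩
  obtain rfl | ha := eq_or_ne a 0
  · exact Or.inr ⟨0, rfl⟩
  obtain rfl | hb := eq_or_ne b 0
  · exact Or.inl ⟨0, rfl⟩
  obtain ⟨m, rfl⟩ := ZMod.natCast_zmod_surjective a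
  obtain ⟨n, rfl⟩ := ZMod.natCast_zmod_surjective b
  obtain ⟨u, s, hs, rfl⟩ :=
    Nat.exists_eq_pow_mul_and_not_dvd (n := m) (by rintro rfl; simp at ha) p hp.ne_one
  obtain ⟨v, t, ht, rfl⟩ :=
    Nat.exists_eq_pow_mul_and_not_dvd (n := n) (by rintro rfl; simp at hb) p hp.ne_one
  by_cases h : u ≤ v ∧ f + u ≤ e + v
  · exact Or.inl (ZMod.exists_hom_of_le hp hs h.1 h.2)
  · exact Or.inr (ZMod.exists_hom_of_le hp ht (by omega) (by omega))

/-- A product of cyclic groups of orders `a`, `b` and `1` can be sorted by order. -/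
theorem nonempty_addEquiv_prod_of_forall_eq {ι : Type*} [Finite ι] {n : ι → ℕ} {a b : ℕ}
    (hab : a ≠ b) (hn : ∀ i, n i = a ∨ n i = b ∨ n i = 1) :
    ∃ m₁ m₂ : ℕ, Nonempty ((∀ i, ZMod (n i)) ≃+ ((Fin m₁ → ZMod a) × (Fin m₂ → ZMod b))) := by
  classical
  let F : (∀ i, ZMod (n i)) →+
      (∀ i : {i // n i = a}, ZMod (n i)) × (∀ i : {i // n i = b}, ZMod (n i)) :=
    { toFun := fun x => (fun i => x i, fun i => x i)
      map_zero' := rfl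
      map_add' := fun _ _ => rfl }
  have hF : Function.Bijective F := by
    constructor
    · intro x y hxy
      have h := Prod.ext_iff.mp hxy
      funext i
      rcases hn i with hi | hi | hi
      · exact congrFun h.1 ⟨i, hi⟩
      · exact congrFun h.2 ⟨i, hi⟩
      · have : Subsingleton (ZMod (n i)) := by rw [hi]; infer_instance
        exact Subsingleton.elim _ _
    · rintro ⟨y, z⟩
      refine ⟨fun i => if h : n i = a then y ⟨i, h⟩ else if h : n i = b then z ⟨i, h⟩ else 0, ?_⟩
      refine Prod.ext (funext fun i => ?_) (funext fun i => ?_)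
      · simp [F, i.2]
      · have hi : n i ≠ a := fun h => hab (h.symm.trans i.2)
        simp only [F, AddMonoidHom.coe_mk, ZeroHom.coe_mk, dif_neg hi, dif_pos i.2]
  have sort (c : ℕ) : (∀ i : {i // n i = c}, ZMod (n i)) ≃+
      (Fin (Nat.card {i // n i = c}) → ZMod c) :=
    (AddEquiv.piCongrRight fun i : {i // n i = c} => (ZMod.ringEquivCongr i.2).toAddEquiv).trans
      (AddEquiv.arrowCongr (Finite.equivFin _) (AddEquiv.refl _))
  exact ⟨_, _, ⟨(AddEquiv.ofBijective F hF).trans ((sort a).prodCongr (sort b))⟩⟩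

section Chain

variable {G : Type*} [AddCommGroup G] {ι : Type*} {p e : ι → ℕ}

theorem nsmul_symm_single_one_eq_zero_iff [DecidableEq ι] {n : ι → ℕ}
    (φ : G ≃+ ∀ i, ZMod (n i)) (i : ι) (m : ℕ) :
    m • φ.symm (Pi.single i 1) = 0 ↔ n i ∣ m := by
  rw [← map_nsmul, map_eq_zero_iff _ φ.symm.injective, ← Pi.single_nsmul, Pi.single_eq_zero_iff,
    nsmul_one, ZMod.natCast_eq_zero_iff]

theorem prime_eq_of_isCharSub_le_total (hp : ∀ i, (p i).Prime)
    (φ : G ≃+ ∀ i, ZMod (p i ^ e i))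
    (h : ∀ H K : AddSubgroup G, IsCharSub H → IsCharSub K → H ≤ K ∨ K ≤ H)
    {i j : ι} (hi : e i ≠ 0) (hj : e j ≠ 0) : p i = p j := by
  classical
  have aux {i j : ι} (hj : e j ≠ 0)
      (hle : (nsmulAddMonoidHom (α := G) (p j ^ e j)).ker ≤
        (nsmulAddMonoidHom (α := G) (p i ^ e i)).ker) : p j = p i := by
    have h1 : p j ^ e j • φ.symm (Pi.single j 1) = 0 :=
      (nsmul_symm_single_one_eq_zero_iff φ j _).2 dvd_rfl
    have h2 : p i ^ e i • φ.symm (Pi.single j 1) = 0 := hle h1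
    rw [nsmul_symm_single_one_eq_zero_iff φ] at h2
    exact (Nat.prime_dvd_prime_iff_eq (hp j) (hp i)).1
      ((hp j).dvd_of_dvd_pow ((dvd_pow_self _ hj).trans h2))
  rcases h _ _ (isCharSub_ker_nsmul G (p i ^ e i)) (isCharSub_ker_nsmul G (p j ^ e j)) with h | h
  · exact aux hi h
  · exact (aux hj h).symm

theorem exponent_le_of_isCharSub_le_total (hp : ∀ i, (p i).Prime)
    (φ : G ≃+ ∀ i, ZMod (p i ^ e i))
    (h : ∀ H K : AddSubgroup G, IsCharSub H → IsCharSub K → H ≤ K ∨ K ≤ H)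
    {i j : ι} (hi : e i ≠ 0) (hj : e j ≠ 0) : e j ≤ e i + 1 := by
  classical
  have hij := prime_eq_of_isCharSub_le_total hp φ h hi hj
  rcases h _ _ (isCharSub_ker_nsmul G (p i ^ e i)) (isCharSub_range_nsmul G (p i)) with h | h
  · have h1 : p i ^ e i • φ.symm (Pi.single i 1) = 0 :=
      (nsmul_symm_single_one_eq_zero_iff φ i _).2 dvd_rfl
    obtain ⟨y, hy⟩ := h h1
    have hy' : p i • φ y i = 1 := by
      have := congrFun (congrArg φ hy) i
      simpa using this
    have hu : IsUnit ((p i : ℕ) : ZMod (p i ^ e i)) :=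
      IsUnit.of_mul_eq_one (φ y i) (by rw [← nsmul_eq_mul, hy'])
    rw [ZMod.isUnit_iff_coprime, Nat.coprime_pow_right_iff (Nat.pos_of_ne_zero hi),
      Nat.coprime_self] at hu
    exact absurd hu (hp i).ne_one
  · have h1 : p i ^ e i • p i • φ.symm (Pi.single j 1) = 0 := h ⟨_, rfl⟩
    rw [← mul_nsmul', nsmul_symm_single_one_eq_zero_iff φ, ← pow_succ, hij] at h1
    exact (Nat.pow_dvd_pow_iff_le_right (hp j).one_lt).1 h1

end Chain

theorem stmt_13 (G : Type*) [AddCommGroup G] [Finite G] :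
    (∀ H K : AddSubgroup G, IsCharSub H → IsCharSub K → H ≤ K ∨ K ≤ H) ↔
    (∃ (p k m1 m2 : ℕ), p.Prime ∧
      Nonempty (G ≃+ ((Fin m1 → ZMod (p ^ k)) × (Fin m2 → ZMod (p ^ (k + 1)))))) := by
  constructor
  · intro h
    obtain ⟨ι, _, p, hp, e, ⟨φ₀⟩⟩ := AddCommGroup.equiv_directSum_zmod_of_finite G
    let φ : G ≃+ ∀ i, ZMod (p i ^ e i) := φ₀.trans (DirectSum.addEquivProd _)
    obtain ⟨q, k, hq, hn⟩ : ∃ q k : ℕ, q.Prime ∧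
        ∀ i, p i ^ e i = q ^ k ∨ p i ^ e i = q ^ (k + 1) ∨ p i ^ e i = 1 := by
      by_cases hne : ∃ i, e i ≠ 0
      · have : Nonempty {i // e i ≠ 0} := nonempty_subtype.2 hne
        obtain ⟨⟨i, hi⟩, hmin⟩ := Finite.exists_min (fun i : {i // e i ≠ 0} => e i)
        refine ⟨p i, e i, hp i, fun j => ?_⟩
        by_cases hj : e j = 0
        · simp [hj]
        · rw [prime_eq_of_isCharSub_le_total hp φ h hi hj]
          have h1 : e i ≤ e j := hmin ⟨j, hj⟩
          have h2 := exponent_le_of_isCharSub_le_total hp φ h hi hj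
          obtain h3 | h3 : e j = e i ∨ e j = e i + 1 := by omega
          · exact Or.inl (by rw [h3])
          · exact Or.inr (Or.inl (by rw [h3]))
      · push Not at hne
        exact ⟨2, 0, Nat.prime_two, fun i => by simp [hne i]⟩
    obtain ⟨m₁, m₂, ⟨ψ⟩⟩ := nonempty_addEquiv_prod_of_forall_eq
      (Nat.pow_right_injective hq.two_le |>.ne k.succ_ne_self.symm) hn
    exact ⟨q, k, m₁, m₂, hq, ⟨φ.trans ψ⟩⟩
  · rintro ⟨p, k, m₁, m₂, hp, ⟨φ⟩⟩ H K hH hK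
    let n : Fin m₁ ⊕ Fin m₂ → ℕ := Sum.elim (fun _ => k) (fun _ => k + 1)
    have hn (i) : k ≤ n i ∧ n i ≤ k + 1 := by
      rcases i with i | i <;> simp [n]
    let ψ := (LinearEquiv.sumPiEquivProdPi ℤ (Fin m₁) (Fin m₂) fun i => ZMod (p ^ n i)).toAddEquiv
    refine isCharSub_le_total_of_addEquiv_pi (A := fun i => ZMod (p ^ n i)) (fun i j => ?_)
      (φ.trans ψ.symm) hH hK
    have hi := hn i
    have hj := hn j
    exact ZMod.exists_hom_total hp (by omega) (by omega)
end

section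
/- For any prime p, there is an order isomorphism between the set of characteristic subgroups of Z_{p^2} × Z_{p^5} and the set of characteristic subgroups of Z_p × Z_{p^2} × Z_{p^4}, each ordered by inclusion. -/
theorem IsCharSub.apply_mem_iff {G : Type*} [AddGroup G] {H : AddSubgroup G} (hH : IsCharSub H)
    (φ : AddAut G) (g : G) : φ g ∈ H ↔ g ∈ H := by
  constructor
  · intro h
    rw [← hH φ] at h
    obtain ⟨x, hx, hxg⟩ := h
    rwa [← φ.injective hxg]
  · intro h
    rw [← hH φ]
    exact ⟨g, h, rfl⟩

theorem isCharSub_of_apply_mem {G : Type*} [AddGroup G] {H : AddSubgroup G}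
    (h : ∀ (φ : AddAut G), ∀ g ∈ H, φ g ∈ H) : IsCharSub H := by
  intro φ
  apply le_antisymm
  · rintro _ ⟨g, hg, rfl⟩
    exact h φ g hg
  · intro g hg
    exact ⟨φ.symm g, h φ.symm g hg, φ.apply_symm_apply g⟩

/-- The elements `g` with `p ^ r • g = 0` and `p ^ s • g ∈ p ^ t • G`. -/
def powerSubgroup (G : Type*) [AddCommGroup G] (p r s t : ℕ) : AddSubgroup G where
  carrier := {g | p ^ r • g = 0 ∧ ∃ h, p ^ s • g = p ^ t • h}
  zero_mem' := ⟨by simp, 0, by simp⟩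
  add_mem' := by
    rintro a b ⟨ha, x, hx⟩ ⟨hb, y, hy⟩
    exact ⟨by rw [nsmul_add, ha, hb, add_zero], x + y, by rw [nsmul_add, hx, hy, nsmul_add]⟩
  neg_mem' := by
    rintro a ⟨ha, x, hx⟩
    exact ⟨by rw [smul_neg, ha, neg_zero], -x, by rw [smul_neg, hx, smul_neg]⟩

theorem mem_powerSubgroup {G : Type*} [AddCommGroup G] {p r s t : ℕ} {g : G} :
    g ∈ powerSubgroup G p r s t ↔ p ^ r • g = 0 ∧ ∃ h, p ^ s • g = p ^ t • h := Iff.rfl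

theorem isCharSub_powerSubgroup (G : Type*) [AddCommGroup G] (p r s t : ℕ) :
    IsCharSub (powerSubgroup G p r s t) := by
  refine isCharSub_of_apply_mem fun φ g ⟨hg, x, hx⟩ => ⟨?_, φ x, ?_⟩
  · rw [← map_nsmul, hg, map_zero]
  · rw [← map_nsmul, hx, map_nsmul]

theorem mk_mem_powerSubgroup {A B : Type*} [AddCommGroup A] [AddCommGroup B] {p r s t : ℕ}
    {a : A} {b : B} :
    (a, b) ∈ powerSubgroup (A × B) p r s t ↔
      a ∈ powerSubgroup A p r s t ∧ b ∈ powerSubgroup B p r s t := by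
  simp only [mem_powerSubgroup, Prod.smul_mk, Prod.mk_eq_zero, Prod.exists, Prod.mk.injEq]
  constructor
  · rintro ⟨⟨h1, h2⟩, x, y, hx, hy⟩
    exact ⟨⟨h1, x, hx⟩, h2, y, hy⟩
  · rintro ⟨⟨h1, x, hx⟩, h2, y, hy⟩
    exact ⟨⟨h1, h2⟩, x, y, hx, hy⟩

theorem pow_dvd_pow_mul_iff {p : ℕ} (hp : p.Prime) (k r : ℕ) (m : ℤ) :
    (p : ℤ) ^ k ∣ (p : ℤ) ^ r * m ↔ (p : ℤ) ^ (k - r) ∣ m := by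
  rcases le_total r k with h | h
  · obtain ⟨d, rfl⟩ := Nat.exists_eq_add_of_le h
    rw [pow_add, mul_dvd_mul_iff_left (pow_ne_zero _ (by exact_mod_cast hp.ne_zero)),
      Nat.add_sub_cancel_left]
  · simp [Nat.sub_eq_zero_of_le h, (pow_dvd_pow (p : ℤ) h).mul_right m]

theorem intCast_mem_powerSubgroup {p : ℕ} (hp : p.Prime) {N k : ℕ} (hN : N = p ^ k)
    (r s t : ℕ) (m : ℤ) :
    (m : ZMod N) ∈ powerSubgroup (ZMod N) p r s t ↔
      (p : ℤ) ^ (k - r) ∣ m ∧ (p : ℤ) ^ (min t k - s) ∣ m := by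
  subst hN
  rw [mem_powerSubgroup]
  refine and_congr ?_ ?_
  · rw [← pow_dvd_pow_mul_iff hp, nsmul_eq_mul]
    have := ZMod.intCast_zmod_eq_zero_iff_dvd ((p : ℤ) ^ r * m) (p ^ k)
    push_cast at this ⊢
    exact this
  · rw [← pow_dvd_pow_mul_iff hp]
    have key (h : ℤ) : p ^ s • (m : ZMod (p ^ k)) = p ^ t • (h : ZMod (p ^ k)) ↔
        (p : ℤ) ^ k ∣ (p : ℤ) ^ s * m - (p : ℤ) ^ t * h := by
      have := ZMod.intCast_zmod_eq_zero_iff_dvd ((p : ℤ) ^ s * m - (p : ℤ) ^ t * h) (p ^ k)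
      push_cast at this
      rw [← this, sub_eq_zero, nsmul_eq_mul, nsmul_eq_mul]
      push_cast
      rfl
    constructor
    · rintro ⟨h, hh⟩
      obtain ⟨h, rfl⟩ := ZMod.intCast_surjective h
      rw [key] at hh
      have h1 := (pow_dvd_pow (p : ℤ) (min_le_right t k)).trans hh
      have h2 := (pow_dvd_pow (p : ℤ) (min_le_left t k)).mul_right h
      exact (dvd_sub_left h2).1 h1
    · intro hd
      rcases le_total t k with htk | htk
      · rw [min_eq_left htk] at hd
        obtain ⟨h, hh⟩ := hd
        exact ⟨h, (key h).2 (by simp [hh])⟩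
      · rw [min_eq_right htk] at hd
        exact ⟨((0 : ℤ) : ZMod (p ^ k)), (key 0).2 (by simpa using hd)⟩

/-- If `B` and `C` meet `A` in subgroups of index at most two, this is the third subgroup of `A`
between `B ⊓ C` and `A`. -/
def diagonalSubgroup {G : Type*} [AddGroup G] (A B C : AddSubgroup G)
    (hB : ∀ g ∈ A, ∀ h ∈ A, g ∉ B → h ∉ B → g + h ∈ B)
    (hC : ∀ g ∈ A, ∀ h ∈ A, g ∉ C → h ∉ C → g + h ∈ C) : AddSubgroup G where
  carrier := {g | g ∈ A ∧ (g ∈ B ↔ g ∈ C)}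
  zero_mem' := ⟨A.zero_mem, iff_of_true B.zero_mem C.zero_mem⟩
  add_mem' := by
    rintro a b ⟨ha, ha'⟩ ⟨hb, hb'⟩
    refine ⟨A.add_mem ha hb, ?_⟩
    by_cases h1 : a ∈ B
    · rw [B.add_mem_cancel_left h1, C.add_mem_cancel_left (ha'.1 h1), hb']
    · by_cases h2 : b ∈ B
      · rw [B.add_mem_cancel_right h2, C.add_mem_cancel_right (hb'.1 h2), ha']
      · exact iff_of_true (hB a ha b hb h1 h2) (hC a ha b hb (by rwa [← ha']) (by rwa [← hb']))
  neg_mem' := by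
    rintro a ⟨ha, ha'⟩
    exact ⟨A.neg_mem ha, by rw [neg_mem_iff, neg_mem_iff, ha']⟩

theorem mem_diagonalSubgroup {G : Type*} [AddGroup G] {A B C : AddSubgroup G}
    {hB : ∀ g ∈ A, ∀ h ∈ A, g ∉ B → h ∉ B → g + h ∈ B}
    {hC : ∀ g ∈ A, ∀ h ∈ A, g ∉ C → h ∉ C → g + h ∈ C} {g : G} :
    g ∈ diagonalSubgroup A B C hB hC ↔ g ∈ A ∧ (g ∈ B ↔ g ∈ C) := Iff.rfl

theorem isCharSub_diagonalSubgroup {G : Type*} [AddGroup G] {A B C : AddSubgroup G}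
    (hA : IsCharSub A) (hB' : IsCharSub B) (hC' : IsCharSub C)
    (hB : ∀ g ∈ A, ∀ h ∈ A, g ∉ B → h ∉ B → g + h ∈ B)
    (hC : ∀ g ∈ A, ∀ h ∈ A, g ∉ C → h ∉ C → g + h ∈ C) :
    IsCharSub (diagonalSubgroup A B C hB hC) := by
  refine isCharSub_of_apply_mem fun φ g hg => ?_
  rw [mem_diagonalSubgroup] at hg ⊢
  rwa [hA.apply_mem_iff, hB'.apply_mem_iff, hC'.apply_mem_iff]

/-- Two elements are related if they lie in the same characteristic subgroups. -/
def CharEquiv {G : Type*} [AddGroup G] (g h : G) : Prop :=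
  ∀ H : AddSubgroup G, IsCharSub H → (g ∈ H ↔ h ∈ H)

theorem CharEquiv.trans {G : Type*} [AddGroup G] {g h k : G} (h₁ : CharEquiv g h)
    (h₂ : CharEquiv h k) : CharEquiv g k := fun H hH => (h₁ H hH).trans (h₂ H hH)

theorem CharEquiv.symm {G : Type*} [AddGroup G] {g h : G} (h₁ : CharEquiv g h) :
    CharEquiv h g := fun H hH => (h₁ H hH).symm

theorem CharEquiv.zero_or_rep_trans {G : Type*} [AddGroup G] {ι : Sort*} {f : ι → G}
    {g h : G} (hgh : CharEquiv g h) (hh : CharEquiv h 0 ∨ ∃ l, CharEquiv h (f l)) :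
    CharEquiv g 0 ∨ ∃ l, CharEquiv g (f l) :=
  hh.imp hgh.trans fun ⟨l, hl⟩ => ⟨l, hgh.trans hl⟩

theorem charEquiv_apply {G : Type*} [AddGroup G] (φ : AddAut G) (g : G) :
    CharEquiv g (φ g) := fun _ hH => (hH.apply_mem_iff φ g).symm

/-- The automorphism `(a, b) ↦ (a, b + f a)`. -/
def shearRight {A B : Type*} [AddCommGroup A] [AddCommGroup B] (f : A →+ B) :
    AddAut (A × B) where
  toFun x := (x.1, x.2 + f x.1)
  invFun x := (x.1, x.2 - f x.1)
  left_inv x := by simp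
  right_inv x := by simp
  map_add' x y := by
    ext
    · rfl
    · simp only [Prod.snd_add, Prod.fst_add, map_add]
      abel

/-- The automorphism `(a, b) ↦ (a + f b, b)`. -/
def shearLeft {A B : Type*} [AddCommGroup A] [AddCommGroup B] (f : B →+ A) :
    AddAut (A × B) where
  toFun x := (x.1 + f x.2, x.2)
  invFun x := (x.1 - f x.2, x.2)
  left_inv x := by simp
  right_inv x := by simp
  map_add' x y := by
    ext
    · simp only [Prod.snd_add, Prod.fst_add, map_add]
      abel
    · rfl

theorem shearRight_apply {A B : Type*} [AddCommGroup A] [AddCommGroup B] (f : A →+ B)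
    (a : A) (b : B) : shearRight f (a, b) = (a, b + f a) := rfl

theorem shearLeft_apply {A B : Type*} [AddCommGroup A] [AddCommGroup B] (f : B →+ A)
    (a : A) (b : B) : shearLeft f (a, b) = (a + f b, b) := rfl

/-- Multiplication by an integer `c`, as a homomorphism `ℤ/N → ℤ/M` when `M ∣ c * N`. -/
def mulHom (N M : ℕ) (c : ℤ) (h : (M : ℤ) ∣ c * N) : ZMod N →+ ZMod M :=
  ZMod.lift N ⟨(Int.castAddHom (ZMod M)).comp (AddMonoidHom.mulLeft c),
    by simpa using (ZMod.intCast_zmod_eq_zero_iff_dvd (c * N) M).2 h⟩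

theorem mulHom_intCast (N M : ℕ) (c : ℤ) (h : (M : ℤ) ∣ c * N) (m : ℤ) :
    mulHom N M c h (m : ZMod N) = ((c * m : ℤ) : ZMod M) := by
  simp [mulHom]

/-- Multiplication by an integer prime to `N`, as an automorphism of `ℤ/N`. -/
noncomputable def unitAut (N : ℕ) (u : ℤ) (h : IsCoprime u N) : AddAut (ZMod N) :=
  AddAut.mulLeft ((ZMod.coe_int_isUnit_iff_isCoprime u N).2 h.symm).unit

theorem unitAut_intCast (N : ℕ) (u : ℤ) (h : IsCoprime u N) (m : ℤ) :
    unitAut N u h (m : ZMod N) = ((u * m : ℤ) : ZMod N) := by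
  simp [unitAut]

theorem exists_eq_unit_mul_pow {p : ℕ} (hp : p.Prime) {N k : ℕ} (hN : N = p ^ k) (x : ZMod N) :
    ∃ (u : ℤ) (i : ℕ), IsCoprime u (p : ℤ) ∧ x = ((u * (p : ℤ) ^ i : ℤ) : ZMod N) := by
  subst hN
  obtain ⟨m, rfl⟩ := ZMod.intCast_surjective x
  by_cases hm : m = 0
  · exact ⟨1, k, isCoprime_one_left, by
      subst hm
      simpa using (by exact_mod_cast (ZMod.natCast_self (p ^ k)).symm)⟩
  · have hf : FiniteMultiplicity (p : ℤ) m :=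
      Int.finiteMultiplicity_iff.2 ⟨by simpa using hp.ne_one, hm⟩
    obtain ⟨u, hu, hu'⟩ := hf.exists_eq_pow_mul_and_not_dvd
    refine ⟨u, _, ?_, by rw [mul_comm, ← hu]⟩
    exact ((Nat.prime_iff_prime_int.1 hp).coprime_iff_not_dvd.2 hu').symm

/-- Labels for the nontrivial orbit classes that determine a characteristic subgroup. -/
inductive OrbitLabel
  | a0 | a1 | b0 | b1 | b2 | b3 | b4 | x01 | x02 | x12 | x13

namespace OrbitLabel

/-- The labels lying in the regular characteristic subgroup with parameters `(a, b)`. -/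
def Regular (a b : ℕ) : OrbitLabel → Prop
  | a0 => a ≤ 0
  | a1 => a ≤ 1
  | b0 => b ≤ 0
  | b1 => b ≤ 1
  | b2 => b ≤ 2
  | b3 => b ≤ 3
  | b4 => b ≤ 4
  | x01 => a ≤ 0 ∧ b ≤ 1
  | x02 => a ≤ 0 ∧ b ≤ 2
  | x12 => a ≤ 1 ∧ b ≤ 2
  | x13 => a ≤ 1 ∧ b ≤ 3

/-- The labels lying in the irregular characteristic subgroup with parameters `(a, b)`. -/
def Irregular (a b : ℕ) (l : OrbitLabel) : Prop :=
  Regular a b l ∧ (Regular (a + 1) b l ↔ Regular a (b + 1) l)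

/-- The closure conditions satisfied by the labels of a characteristic subgroup. -/
structure Admissible (p : ℕ) (S : OrbitLabel → Prop) : Prop where
  a0_a1 : S a0 → S a1
  b0_b1 : S b0 → S b1
  b1_b2 : S b1 → S b2
  b2_b3 : S b2 → S b3
  b3_b4 : S b3 → S b4
  a0_b3 : S a0 → S b3
  a1_b4 : S a1 → S b4
  b0_a0 : S b0 → S a0
  b1_a1 : S b1 → S a1
  x01_a1 : S x01 → S a1
  x01_b2 : S x01 → S b2
  x02_a1 : S x02 → S a1
  x02_b3 : S x02 → S b3
  x12_b3 : S x12 → S b3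
  x13_b4 : S x13 → S b4
  a0_b1 : S a0 → (S b1 ↔ S x01)
  a0_b2 : S a0 → (S b2 ↔ S x02)
  a1_b2 : S a1 → (S b2 ↔ S x12)
  a1_b3 : S a1 → (S b3 ↔ S x13)
  b1_a0 : S b1 → (S a0 ↔ S x01)
  b2_a0 : S b2 → (S a0 ↔ S x02)
  b2_a1 : S b2 → (S a1 ↔ S x12)
  b3_a1 : S b3 → (S a1 ↔ S x13)
  x01_x02 : S x01 → S x02 → S b1
  x02_x12 : S x02 → S x12 → S a0
  x12_x13 : S x12 → S x13 → S b2
  x01_of_odd : p ≠ 2 → S x01 → S a0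
  x02_of_odd : p ≠ 2 → S x02 → S a0
  x12_of_odd : p ≠ 2 → S x12 → S a1
  x13_of_odd : p ≠ 2 → S x13 → S a1

theorem Admissible.regular_or_irregular {p : ℕ} {S : OrbitLabel → Prop} (h : Admissible p S) :
    (∃ a b, a ≤ 2 ∧ a ≤ b ∧ b ≤ a + 3 ∧ ∀ l, S l ↔ Regular a b l) ∨
    (p = 2 ∧ ∃ a b, a ≤ 1 ∧ a < b ∧ b < a + 3 ∧ ∀ l, S l ↔ Irregular a b l) := by
  have h_forall (P : OrbitLabel → Prop) : (∀ l, P l) ↔ P a0 ∧ P a1 ∧ P b0 ∧ P b1 ∧ P b2 ∧ P b3 ∧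
      P b4 ∧ P x01 ∧ P x02 ∧ P x12 ∧ P x13 :=
    ⟨fun h => ⟨h _, h _, h _, h _, h _, h _, h _, h _, h _, h _, h _⟩, fun h l => by
      cases l <;> tauto⟩
  by_contra hn
  have h_regular (a b : ℕ) (ha : a ≤ 2) (hab : a ≤ b) (hb : b ≤ a + 3) :
      ¬ ∀ l, S l ↔ Regular a b l :=
    fun h' => hn (Or.inl ⟨a, b, ha, hab, hb, h'⟩)
  have h_irregular (a b : ℕ) (hp : p = 2) (ha : a ≤ 1) (hab : a < b) (hb : b < a + 3) :
      ¬ ∀ l, S l ↔ Irregular a b l :=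
    fun h' => hn (Or.inr ⟨hp, a, b, ha, hab, hb, h'⟩)
  clear hn
  have hs01 (ha : ¬ S a0) (hx : S x01) : p = 2 := by
    by_contra hp; exact ha (h.x01_of_odd hp hx)
  have hs02 (ha : ¬ S a0) (hx : S x02) : p = 2 := by
    by_contra hp; exact ha (h.x02_of_odd hp hx)
  have hs12 (ha : ¬ S a1) (hx : S x12) : p = 2 := by
    by_contra hp; exact ha (h.x12_of_odd hp hx)
  have hs13 (ha : ¬ S a1) (hx : S x13) : p = 2 := by
    by_contra hp; exact ha (h.x13_of_odd hp hx)
  obtain ⟨r1, r2, r3, r4, r5, r6, r7, r8, r9, r10, r11, r12, r13, r14, r15, r16, r17, r18, r19,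
    r20, r21, r22, r23, r24, r25, r26, -, -, -, -⟩ := h
  simp only [h_forall, Irregular, Regular] at h_regular h_irregular
  have g00 := h_regular 0 0
  have g01 := h_regular 0 1
  have g02 := h_regular 0 2
  have g03 := h_regular 0 3
  have g11 := h_regular 1 1
  have g12 := h_regular 1 2
  have g13 := h_regular 1 3
  have g14 := h_regular 1 4
  have g22 := h_regular 2 2
  have g23 := h_regular 2 3
  have g24 := h_regular 2 4
  have g25 := h_regular 2 5
  have i01 := h_irregular 0 1
  have i02 := h_irregular 0 2
  have i12 := h_irregular 1 2
  have i13 := h_irregular 1 3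
  clear h_regular h_irregular h_forall
  norm_num at g00 g01 g02 g03 g11 g12 g13 g14 g22 g23 g24 g25 i01 i02 i12 i13
  by_cases S a0 <;> by_cases S a1 <;> by_cases S b1 <;> by_cases S b2 <;> by_cases S b3 <;>
    first
    | grind
    | by_cases S x01 <;> by_cases S x02 <;> by_cases S x12 <;> by_cases S x13 <;> by_cases S b4 <;>
        by_cases S b0 <;> grind

end OrbitLabel

open OrbitLabel

/-- A family of elements of `G`, indexed by `OrbitLabel`, that determines every characteristic
subgroup and meets the characteristic subgroups in exactly the admissible sets of labels. -/
structure OrbitClassification (p : ℕ) (G : Type*) [AddCommGroup G] where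
  rep : OrbitLabel → G
  charEquiv_zero_or_rep : ∀ g, CharEquiv g 0 ∨ ∃ l, CharEquiv g (rep l)
  admissible : ∀ H, IsCharSub H → Admissible p (fun l => rep l ∈ H)
  exists_of_admissible : ∀ S, Admissible p S → ∃ H, IsCharSub H ∧ ∀ l, rep l ∈ H ↔ S l

/-- The characteristic subgroups of a classified group correspond to admissible sets of labels. -/
noncomputable def OrbitClassification.orderIso {p : ℕ} {G : Type*} [AddCommGroup G]
    (c : OrbitClassification p G) :
    {H : AddSubgroup G // IsCharSub H} ≃o {S : OrbitLabel → Prop // Admissible p S} :=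
  RelIso.ofSurjective
    (OrderEmbedding.ofMapLEIff
      (fun H : {H : AddSubgroup G // IsCharSub H} =>
        (⟨fun l => c.rep l ∈ H.1, c.admissible H.1 H.2⟩ :
          {S : OrbitLabel → Prop // Admissible p S}))
      (by
        intro H K
        constructor
        · intro h g hg
          rcases c.charEquiv_zero_or_rep g with h0 | ⟨l, hl⟩
          · exact (h0 K.1 K.2).2 K.1.zero_mem
          · exact (hl K.1 K.2).2 (h l ((hl H.1 H.2).1 hg))
        · exact fun h l hl => h hl))
    (by
      rintro ⟨S, hS⟩
      obtain ⟨H, hH, h⟩ := c.exists_of_admissible S hS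
      exact ⟨⟨H, hH⟩, Subtype.ext (funext fun l => propext (h l))⟩)

theorem exists_isCharSub_of_admissible {p : ℕ} {G : Type*} [AddCommGroup G]
    (rep : OrbitLabel → G) (R : ℕ → ℕ → AddSubgroup G) (hR : ∀ a b, IsCharSub (R a b))
    (h_mem : ∀ a b, a ≤ 2 → a ≤ b → b ≤ a + 3 → ∀ l, rep l ∈ R a b ↔ Regular a b l)
    (h_add : p = 2 → ∀ a b a' b', a ≤ 1 → a < b → b < a + 3 →
      (a' = a + 1 ∧ b' = b ∨ a' = a ∧ b' = b + 1) → ∀ g ∈ R a b, ∀ h ∈ R a b,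
      g ∉ R a' b' → h ∉ R a' b' → g + h ∈ R a' b')
    (S : OrbitLabel → Prop) (hS : Admissible p S) :
    ∃ H, IsCharSub H ∧ ∀ l, rep l ∈ H ↔ S l := by
  rcases hS.regular_or_irregular with ⟨a, b, ha, hab, hb, h⟩ | ⟨hp, a, b, ha, hab, hb, h⟩
  · exact ⟨R a b, hR a b, fun l => by rw [h_mem a b ha hab hb, h]⟩
  · refine ⟨diagonalSubgroup (R a b) (R (a + 1) b) (R a (b + 1))
      (h_add hp a b _ _ ha hab hb (Or.inl ⟨rfl, rfl⟩))
      (h_add hp a b _ _ ha hab hb (Or.inr ⟨rfl, rfl⟩)),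
      isCharSub_diagonalSubgroup (hR _ _) (hR _ _) (hR _ _) _ _, fun l => ?_⟩
    rw [mem_diagonalSubgroup, h_mem a b (by omega) (by omega) (by omega),
      h_mem (a + 1) b (by omega) (by omega) (by omega),
      h_mem a (b + 1) (by omega) (by omega) (by omega), h]
    rfl

theorem isCoprime_one_sub (p : ℕ) : IsCoprime (1 - (p : ℤ)) p := ⟨1, 1, by ring⟩

theorem isCoprime_two_of_ne_two {p : ℕ} (hp : p.Prime) (hp2 : p ≠ 2) :
    IsCoprime (2 : ℤ) p := by
  exact_mod_cast Nat.isCoprime_iff_coprime.2 ((Nat.coprime_primes Nat.prime_two hp).2 hp2.symm)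

namespace TwoFactors

/-- The element of `ℤ/p² × ℤ/p⁵` given by a pair of integers. -/
def mk (p : ℕ) (m n : ℤ) : ZMod (p ^ 2) × ZMod (p ^ 5) := (m, n)

variable {p : ℕ}

theorem mk_add (m n m' n' : ℤ) : mk p m n + mk p m' n' = mk p (m + m') (n + n') := by
  simp [mk]

theorem mk_sub (m n m' n' : ℤ) : mk p m n - mk p m' n' = mk p (m - m') (n - n') := by
  simp [mk]

theorem mk_zero : mk p 0 0 = 0 := by simp [mk]

theorem mk_fst_eq_zero {i : ℕ} (hi : 2 ≤ i) (n : ℤ) : mk p ((p : ℤ) ^ i) n = mk p 0 n := by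
  have := (ZMod.intCast_zmod_eq_zero_iff_dvd ((p : ℤ) ^ i) (p ^ 2)).2
    (by push_cast; exact pow_dvd_pow _ hi)
  simp only [mk, this, Int.cast_zero]

theorem mk_snd_eq_zero {j : ℕ} (hj : 5 ≤ j) (m : ℤ) : mk p m ((p : ℤ) ^ j) = mk p m 0 := by
  have := (ZMod.intCast_zmod_eq_zero_iff_dvd ((p : ℤ) ^ j) (p ^ 5)).2
    (by push_cast; exact pow_dvd_pow _ hj)
  simp only [mk, this, Int.cast_zero]

theorem charEquiv_mul_fst {u : ℤ} (hu : IsCoprime u (p : ℤ)) (m n : ℤ) :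
    CharEquiv (mk p m n) (mk p (u * m) n) := by
  have h : CharEquiv (mk p m n) (unitAut _ u _ m, (n : ZMod (p ^ 5))) :=
    charEquiv_apply ((unitAut (p ^ 2) u (by push_cast; exact hu.pow_right)).prodCongr
      (AddEquiv.refl (ZMod (p ^ 5)))) (mk p m n)
  rwa [unitAut_intCast] at h

theorem charEquiv_mul_snd {u : ℤ} (hu : IsCoprime u (p : ℤ)) (m n : ℤ) :
    CharEquiv (mk p m n) (mk p m (u * n)) := by
  have h : CharEquiv (mk p m n) ((m : ZMod (p ^ 2)), unitAut _ u _ n) :=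
    charEquiv_apply ((AddEquiv.refl (ZMod (p ^ 2))).prodCongr
      (unitAut (p ^ 5) u (by push_cast; exact hu.pow_right))) (mk p m n)
  rwa [unitAut_intCast] at h

theorem charEquiv_add_fst (c m n : ℤ) : CharEquiv (mk p m n) (mk p (m + c * n) n) := by
  have h := charEquiv_apply (shearLeft (mulHom (p ^ 5) (p ^ 2) c
    (by push_cast; exact (pow_dvd_pow _ (by norm_num)).mul_left c))) (mk p m n)
  rwa [mk, shearLeft_apply, mulHom_intCast, ← Int.cast_add] at h

theorem charEquiv_add_snd (c m n : ℤ) :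
    CharEquiv (mk p m n) (mk p m (n + p ^ 3 * c * m)) := by
  have h := charEquiv_apply (shearRight (mulHom (p ^ 2) (p ^ 5) (p ^ 3 * c)
    (by push_cast; exact ⟨c, by ring⟩))) (mk p m n)
  rwa [mk, shearRight_apply, mulHom_intCast, ← Int.cast_add] at h

/-- The representative of each label in `ℤ/p² × ℤ/p⁵`. -/
def rep (p : ℕ) : OrbitLabel → ZMod (p ^ 2) × ZMod (p ^ 5)
  | a0 => mk p (p ^ 0) 0
  | a1 => mk p (p ^ 1) 0
  | b0 => mk p 0 (p ^ 0)
  | b1 => mk p 0 (p ^ 1)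
  | b2 => mk p 0 (p ^ 2)
  | b3 => mk p 0 (p ^ 3)
  | b4 => mk p 0 (p ^ 4)
  | x01 => mk p (p ^ 0) (p ^ 1)
  | x02 => mk p (p ^ 0) (p ^ 2)
  | x12 => mk p (p ^ 1) (p ^ 2)
  | x13 => mk p (p ^ 1) (p ^ 3)

theorem charEquiv_pow_fst_zero {i j : ℕ} (h : j ≤ i) :
    CharEquiv (mk p (p ^ i) (p ^ j)) (mk p 0 (p ^ j)) := by
  obtain ⟨d, rfl⟩ := Nat.exists_eq_add_of_le h
  convert charEquiv_add_fst (p := p) (-p ^ d) (p ^ (j + d)) (p ^ j) using 2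
  ring

theorem charEquiv_pow_snd_zero {i j : ℕ} (h : i + 3 ≤ j) :
    CharEquiv (mk p (p ^ i) (p ^ j)) (mk p (p ^ i) 0) := by
  obtain ⟨d, rfl⟩ := Nat.exists_eq_add_of_le h
  convert charEquiv_add_snd (p := p) (-p ^ d) (p ^ i) (p ^ (i + 3 + d)) using 2
  ring

theorem charEquiv_zero_or_rep (hp : p.Prime) (g : ZMod (p ^ 2) × ZMod (p ^ 5)) :
    CharEquiv g 0 ∨ ∃ l, CharEquiv g (rep p l) := by
  obtain ⟨x, y⟩ := g
  obtain ⟨u, i, hu, rfl⟩ := exists_eq_unit_mul_pow hp rfl x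
  obtain ⟨v, j, hv, rfl⟩ := exists_eq_unit_mul_pow hp rfl y
  have key : CharEquiv (mk p (u * p ^ i) (v * p ^ j)) (mk p (p ^ i) (p ^ j)) :=
    ((charEquiv_mul_fst hu _ _).trans (charEquiv_mul_snd hv _ _)).symm
  suffices h : CharEquiv (mk p (p ^ i) (p ^ j)) 0 ∨
      ∃ l, CharEquiv (mk p (p ^ i) (p ^ j)) (rep p l) by
    rcases h with h | ⟨l, h⟩
    · exact Or.inl (key.trans h)
    · exact Or.inr ⟨l, key.trans h⟩
  clear key
  by_cases hij : 2 ≤ i ∨ j ≤ i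
  · have h : CharEquiv (mk p (p ^ i) (p ^ j)) (mk p 0 (p ^ j)) := by
      rcases hij with hi | hij
      · rw [mk_fst_eq_zero hi]
        exact fun _ _ => Iff.rfl
      · exact charEquiv_pow_fst_zero hij
    rcases le_or_gt 5 j with hj | hj
    · rw [mk_snd_eq_zero hj 0, mk_zero] at h
      exact Or.inl h
    · interval_cases j
      exacts [Or.inr ⟨b0, h⟩, Or.inr ⟨b1, h⟩, Or.inr ⟨b2, h⟩, Or.inr ⟨b3, h⟩, Or.inr ⟨b4, h⟩]
  · obtain ⟨hi, hji⟩ : i < 2 ∧ i < j := by omega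
    right
    rcases le_or_gt (i + 3) j with hj | hj
    · have h := charEquiv_pow_snd_zero (p := p) hj
      interval_cases i
      exacts [⟨a0, h⟩, ⟨a1, h⟩]
    · interval_cases i <;> interval_cases j
      exacts [⟨x01, fun _ _ => Iff.rfl⟩, ⟨x02, fun _ _ => Iff.rfl⟩, ⟨x12, fun _ _ => Iff.rfl⟩,
        ⟨x13, fun _ _ => Iff.rfl⟩]

theorem mul_fst_mem {H : AddSubgroup (ZMod (p ^ 2) × ZMod (p ^ 5))} (hH : IsCharSub H)
    {m n : ℤ} (h : mk p m n ∈ H) : mk p (p * m) 0 ∈ H := by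
  have := H.sub_mem h ((charEquiv_mul_fst (isCoprime_one_sub p) m n H hH).1 h)
  rw [mk_sub] at this
  convert this using 2 <;> ring

theorem mul_snd_mem {H : AddSubgroup (ZMod (p ^ 2) × ZMod (p ^ 5))} (hH : IsCharSub H)
    {m n : ℤ} (h : mk p m n ∈ H) : mk p 0 (p * n) ∈ H := by
  have := H.sub_mem h ((charEquiv_mul_snd (isCoprime_one_sub p) m n H hH).1 h)
  rw [mk_sub] at this
  convert this using 2 <;> ring

theorem fst_mem_of_ne_two {H : AddSubgroup (ZMod (p ^ 2) × ZMod (p ^ 5))} (hH : IsCharSub H)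
    (hp : p.Prime) (hp2 : p ≠ 2) {m n : ℤ} (h : mk p m n ∈ H) :
    mk p m 0 ∈ H := by
  have := H.sub_mem h ((charEquiv_mul_fst isCoprime_one_left.neg_left m n H hH).1 h)
  rw [mk_sub] at this
  refine (charEquiv_mul_fst (isCoprime_two_of_ne_two hp hp2) m 0 H hH).2 ?_
  convert this using 2 <;> ring

theorem snd_mem_iff {H : AddSubgroup (ZMod (p ^ 2) × ZMod (p ^ 5))} {m n : ℤ}
    (h : mk p m 0 ∈ H) : mk p 0 n ∈ H ↔ mk p m n ∈ H := by
  rw [← H.add_mem_cancel_left h, mk_add, add_zero, zero_add]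

theorem fst_mem_iff {H : AddSubgroup (ZMod (p ^ 2) × ZMod (p ^ 5))} {m n : ℤ}
    (h : mk p 0 n ∈ H) : mk p m 0 ∈ H ↔ mk p m n ∈ H := by
  rw [← H.add_mem_cancel_right h, mk_add, add_zero, zero_add]

theorem admissible {H : AddSubgroup (ZMod (p ^ 2) × ZMod (p ^ 5))} (hp : p.Prime)
    (hH : IsCharSub H) : Admissible p (fun l => rep p l ∈ H) where
  a0_a1 h := by simpa [rep] using mul_fst_mem hH h
  b0_b1 h := by simpa [rep] using mul_snd_mem hH h
  b1_b2 h := by simpa [rep, ← sq] using mul_snd_mem hH h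
  b2_b3 h := by simpa only [rep, ← pow_succ'] using mul_snd_mem hH h
  b3_b4 h := by simpa only [rep, ← pow_succ'] using mul_snd_mem hH h
  a0_b3 h := (snd_mem_iff h).2 (by simpa [rep] using (charEquiv_add_snd 1 _ _ H hH).1 h)
  a1_b4 h := (snd_mem_iff h).2 (by
    simpa [rep, ← pow_succ] using (charEquiv_add_snd 1 _ _ H hH).1 h)
  b0_a0 h := (fst_mem_iff h).2 (by simpa [rep] using (charEquiv_add_fst 1 _ _ H hH).1 h)
  b1_a1 h := (fst_mem_iff h).2 (by simpa [rep] using (charEquiv_add_fst 1 _ _ H hH).1 h)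
  x01_a1 h := by simpa [rep] using mul_fst_mem hH h
  x01_b2 h := by simpa [rep, ← sq] using mul_snd_mem hH h
  x02_a1 h := by simpa [rep] using mul_fst_mem hH h
  x02_b3 h := by simpa only [rep, ← pow_succ'] using mul_snd_mem hH h
  x12_b3 h := by simpa only [rep, ← pow_succ'] using mul_snd_mem hH h
  x13_b4 h := by simpa only [rep, ← pow_succ'] using mul_snd_mem hH h
  a0_b1 h := snd_mem_iff h
  a0_b2 h := snd_mem_iff h
  a1_b2 h := snd_mem_iff h
  a1_b3 h := snd_mem_iff h
  b1_a0 h := fst_mem_iff h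
  b2_a0 h := fst_mem_iff h
  b2_a1 h := fst_mem_iff h
  b3_a1 h := fst_mem_iff h
  x01_x02 h h' := by
    have := H.sub_mem h h'
    rw [rep, rep, mk_sub] at this
    refine (charEquiv_mul_snd (isCoprime_one_sub p) _ _ H hH).2 ?_
    convert this using 2 <;> ring
  x02_x12 h h' := by
    have := H.sub_mem h h'
    rw [rep, rep, mk_sub] at this
    refine (charEquiv_mul_fst (isCoprime_one_sub p) _ _ H hH).2 ?_
    convert this using 2 <;> ring
  x12_x13 h h' := by
    have := H.sub_mem h h'
    rw [rep, rep, mk_sub] at this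
    refine (charEquiv_mul_snd (isCoprime_one_sub p) _ _ H hH).2 ?_
    convert this using 2 <;> ring
  x01_of_odd hp2 h := fst_mem_of_ne_two hH hp hp2 h
  x02_of_odd hp2 h := fst_mem_of_ne_two hH hp hp2 h
  x12_of_odd hp2 h := fst_mem_of_ne_two hH hp hp2 h
  x13_of_odd hp2 h := fst_mem_of_ne_two hH hp hp2 h

/-- The characteristic subgroup with parameters `(a, b)`. -/
def regularSubgroup (p a b : ℕ) : AddSubgroup (ZMod (p ^ 2) × ZMod (p ^ 5)) :=
  powerSubgroup _ p (5 - b) 0 a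

theorem mk_mem_regularSubgroup (hp : p.Prime) (a b : ℕ) (m n : ℤ) :
    mk p m n ∈ regularSubgroup p a b ↔
      ((p : ℤ) ^ (2 - (5 - b)) ∣ m ∧ (p : ℤ) ^ (min a 2 - 0) ∣ m) ∧
      ((p : ℤ) ^ (5 - (5 - b)) ∣ n ∧ (p : ℤ) ^ (min a 5 - 0) ∣ n) := by
  rw [regularSubgroup, mk, mk_mem_powerSubgroup, intCast_mem_powerSubgroup hp rfl,
    intCast_mem_powerSubgroup hp rfl]

theorem rep_mem_regularSubgroup (hp : p.Prime) {a b : ℕ} (ha : a ≤ 2) (hab : a ≤ b)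
    (hb : b ≤ a + 3) (l : OrbitLabel) : rep p l ∈ regularSubgroup p a b ↔ Regular a b l := by
  have h_dvd (i j : ℕ) : (p : ℤ) ^ i ∣ (p : ℤ) ^ j ↔ i ≤ j :=
    pow_dvd_pow_iff (by exact_mod_cast hp.ne_zero)
      (by simpa [Int.isUnit_iff_natAbs_eq] using hp.ne_one)
  cases l <;> simp only [rep, mk_mem_regularSubgroup hp, h_dvd, dvd_zero, and_true, true_and,
    Regular] <;> omega

theorem add_mem_regularSubgroup (hp : p = 2) {a b a' b' : ℕ} (ha : a ≤ 1) (hab : a < b)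
    (hb : b < a + 3) (h' : a' = a + 1 ∧ b' = b ∨ a' = a ∧ b' = b + 1) :
    ∀ g ∈ regularSubgroup p a b, ∀ h ∈ regularSubgroup p a b,
      g ∉ regularSubgroup p a' b' → h ∉ regularSubgroup p a' b' →
      g + h ∈ regularSubgroup p a' b' := by
  subst hp
  rintro ⟨x, y⟩ hg ⟨x', y'⟩ hh
  obtain ⟨m, rfl⟩ := ZMod.intCast_surjective x
  obtain ⟨n, rfl⟩ := ZMod.intCast_surjective y
  obtain ⟨m', rfl⟩ := ZMod.intCast_surjective x'
  obtain ⟨n', rfl⟩ := ZMod.intCast_surjective y'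
  change mk 2 m n ∈ _ at hg
  change mk 2 m' n' ∈ _ at hh
  change mk 2 m n ∉ _ → mk 2 m' n' ∉ _ → mk 2 m n + mk 2 m' n' ∈ _
  rw [mk_add]
  simp only [mk_mem_regularSubgroup Nat.prime_two] at hg hh ⊢
  rcases h' with ⟨ha', hb'⟩ | ⟨ha', hb'⟩ <;>
    simp only [ha', hb'] <;> interval_cases a <;> interval_cases b <;>
    norm_num at hg hh ⊢ <;> omega

/-- The classification for `ℤ/p² × ℤ/p⁵`. -/
def orbitClassification (hp : p.Prime) : OrbitClassification p (ZMod (p ^ 2) × ZMod (p ^ 5)) where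
  rep := rep p
  charEquiv_zero_or_rep := charEquiv_zero_or_rep hp
  admissible _ := admissible hp
  exists_of_admissible := exists_isCharSub_of_admissible (rep p) (regularSubgroup p)
    (fun _ _ => isCharSub_powerSubgroup _ _ _ _ _)
    (fun _ _ ha hab hb => rep_mem_regularSubgroup hp ha hab hb)
    (fun hp _ _ _ _ ha hab hb h => add_mem_regularSubgroup hp ha hab hb h)

end TwoFactors

namespace ThreeFactors

/-- The element of `ℤ/p × ℤ/p² × ℤ/p⁴` given by a triple of integers. -/
def mk (p : ℕ) (l m n : ℤ) : ZMod p × ZMod (p ^ 2) × ZMod (p ^ 4) := (l, m, n)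

variable {p : ℕ}

theorem mk_add (l m n l' m' n' : ℤ) :
    mk p l m n + mk p l' m' n' = mk p (l + l') (m + m') (n + n') := by
  simp [mk]

theorem mk_sub (l m n l' m' n' : ℤ) :
    mk p l m n - mk p l' m' n' = mk p (l - l') (m - m') (n - n') := by
  simp [mk]

theorem mk_zero : mk p 0 0 0 = 0 := by simp [mk]

theorem mk_fst_eq_zero {i : ℕ} (hi : 1 ≤ i) (m n : ℤ) :
    mk p ((p : ℤ) ^ i) m n = mk p 0 m n := by
  have := (ZMod.intCast_zmod_eq_zero_iff_dvd ((p : ℤ) ^ i) p).2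
    (dvd_pow_self _ (by omega))
  simp only [mk, this, Int.cast_zero]

theorem mk_snd_eq_zero {j : ℕ} (hj : 2 ≤ j) (l n : ℤ) :
    mk p l ((p : ℤ) ^ j) n = mk p l 0 n := by
  have := (ZMod.intCast_zmod_eq_zero_iff_dvd ((p : ℤ) ^ j) (p ^ 2)).2
    (by push_cast; exact pow_dvd_pow _ hj)
  simp only [mk, this, Int.cast_zero]

theorem mk_thd_eq_zero {k : ℕ} (hk : 4 ≤ k) (l m : ℤ) :
    mk p l m ((p : ℤ) ^ k) = mk p l m 0 := by
  have := (ZMod.intCast_zmod_eq_zero_iff_dvd ((p : ℤ) ^ k) (p ^ 4)).2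
    (by push_cast; exact pow_dvd_pow _ hk)
  simp only [mk, this, Int.cast_zero]

theorem charEquiv_mul_fst {u : ℤ} (hu : IsCoprime u (p : ℤ)) (l m n : ℤ) :
    CharEquiv (mk p l m n) (mk p (u * l) m n) := by
  have h : CharEquiv (mk p l m n) (unitAut _ u _ l, (m : ZMod (p ^ 2)), (n : ZMod (p ^ 4))) :=
    charEquiv_apply ((unitAut p u hu).prodCongr
      (AddEquiv.refl (ZMod (p ^ 2) × ZMod (p ^ 4)))) (mk p l m n)
  rwa [unitAut_intCast] at h

theorem charEquiv_mul_snd {u : ℤ} (hu : IsCoprime u (p : ℤ)) (l m n : ℤ) :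
    CharEquiv (mk p l m n) (mk p l (u * m) n) := by
  have h : CharEquiv (mk p l m n) ((l : ZMod p), unitAut _ u _ m, (n : ZMod (p ^ 4))) :=
    charEquiv_apply ((AddEquiv.refl (ZMod p)).prodCongr
      ((unitAut (p ^ 2) u (by push_cast; exact hu.pow_right)).prodCongr
        (AddEquiv.refl (ZMod (p ^ 4))))) (mk p l m n)
  rwa [unitAut_intCast] at h

theorem charEquiv_mul_thd {u : ℤ} (hu : IsCoprime u (p : ℤ)) (l m n : ℤ) :
    CharEquiv (mk p l m n) (mk p l m (u * n)) := by
  have h : CharEquiv (mk p l m n) ((l : ZMod p), (m : ZMod (p ^ 2)), unitAut _ u _ n) :=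
    charEquiv_apply ((AddEquiv.refl (ZMod p)).prodCongr
      ((AddEquiv.refl (ZMod (p ^ 2))).prodCongr
        (unitAut (p ^ 4) u (by push_cast; exact hu.pow_right)))) (mk p l m n)
  rwa [unitAut_intCast] at h

theorem charEquiv_add_fst_snd (c l m n : ℤ) :
    CharEquiv (mk p l m n) (mk p (l + c * m) m n) := by
  have h := charEquiv_apply (shearLeft ((mulHom (p ^ 2) p c
    (by push_cast; exact ⟨c * p, by ring⟩)).comp
    (AddMonoidHom.fst (ZMod (p ^ 2)) (ZMod (p ^ 4))))) (mk p l m n)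
  rwa [mk, shearLeft_apply, AddMonoidHom.comp_apply, AddMonoidHom.coe_fst, mulHom_intCast,
    ← Int.cast_add] at h

theorem charEquiv_add_fst_thd (c l m n : ℤ) :
    CharEquiv (mk p l m n) (mk p (l + c * n) m n) := by
  have h := charEquiv_apply (shearLeft ((mulHom (p ^ 4) p c
    (by push_cast; exact ⟨c * p ^ 3, by ring⟩)).comp
    (AddMonoidHom.snd (ZMod (p ^ 2)) (ZMod (p ^ 4))))) (mk p l m n)
  rwa [mk, shearLeft_apply, AddMonoidHom.comp_apply, AddMonoidHom.coe_snd, mulHom_intCast,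
    ← Int.cast_add] at h

theorem charEquiv_add_snd_fst (c l m n : ℤ) :
    CharEquiv (mk p l m n) (mk p l (m + p * c * l) n) := by
  have h := charEquiv_apply (shearRight ((AddMonoidHom.inl (ZMod (p ^ 2)) (ZMod (p ^ 4))).comp
    (mulHom p (p ^ 2) (p * c) (by push_cast; exact ⟨c, by ring⟩)))) (mk p l m n)
  rwa [mk, shearRight_apply, AddMonoidHom.comp_apply, AddMonoidHom.inl_apply, mulHom_intCast,
    Prod.mk_add_mk, ← Int.cast_add, add_zero] at h

theorem charEquiv_add_thd_fst (c l m n : ℤ) :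
    CharEquiv (mk p l m n) (mk p l m (n + p ^ 3 * c * l)) := by
  have h := charEquiv_apply (shearRight ((AddMonoidHom.inr (ZMod (p ^ 2)) (ZMod (p ^ 4))).comp
    (mulHom p (p ^ 4) (p ^ 3 * c) (by push_cast; exact ⟨c, by ring⟩)))) (mk p l m n)
  rwa [mk, shearRight_apply, AddMonoidHom.comp_apply, AddMonoidHom.inr_apply, mulHom_intCast,
    Prod.mk_add_mk, ← Int.cast_add, add_zero] at h

theorem charEquiv_add_snd_thd (c l m n : ℤ) :
    CharEquiv (mk p l m n) (mk p l (m + c * n) n) := by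
  have h : CharEquiv (mk p l m n) ((l : ZMod p), shearLeft _ _) :=
    charEquiv_apply ((AddEquiv.refl (ZMod p)).prodCongr (shearLeft (mulHom (p ^ 4) (p ^ 2) c
      (by push_cast; exact ⟨c * p ^ 2, by ring⟩)))) (mk p l m n)
  rwa [mk, shearLeft_apply, mulHom_intCast, ← Int.cast_add] at h

theorem charEquiv_add_thd_snd (c l m n : ℤ) :
    CharEquiv (mk p l m n) (mk p l m (n + p ^ 2 * c * m)) := by
  have h : CharEquiv (mk p l m n) ((l : ZMod p), shearRight _ _) :=
    charEquiv_apply ((AddEquiv.refl (ZMod p)).prodCongr (shearRight (mulHom (p ^ 2) (p ^ 4)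
      (p ^ 2 * c) (by push_cast; exact ⟨c, by ring⟩)))) (mk p l m n)
  rwa [mk, shearRight_apply, mulHom_intCast, ← Int.cast_add] at h

/-- The representative of each label in `ℤ/p × ℤ/p² × ℤ/p⁴`. -/
def rep (p : ℕ) : OrbitLabel → ZMod p × ZMod (p ^ 2) × ZMod (p ^ 4)
  | a0 => mk p 0 0 (p ^ 1)
  | a1 => mk p 0 0 (p ^ 2)
  | b0 => mk p 0 0 (p ^ 0)
  | b1 => mk p 0 (p ^ 0) 0
  | b2 => mk p (p ^ 0) 0 0
  | b3 => mk p 0 (p ^ 1) 0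
  | b4 => mk p 0 0 (p ^ 3)
  | x01 => mk p 0 (p ^ 0) (p ^ 1)
  | x02 => mk p (p ^ 0) 0 (p ^ 1)
  | x12 => mk p (p ^ 0) 0 (p ^ 2)
  | x13 => mk p 0 (p ^ 1) (p ^ 2)

theorem charEquiv_thd (k : ℕ) :
    CharEquiv (mk p 0 0 (p ^ k)) 0 ∨ ∃ l, CharEquiv (mk p 0 0 (p ^ k)) (rep p l) := by
  rcases le_or_gt 4 k with hk | hk
  · rw [mk_thd_eq_zero hk, mk_zero]
    exact Or.inl fun _ _ => Iff.rfl
  · right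
    interval_cases k
    exacts [⟨b0, fun _ _ => Iff.rfl⟩, ⟨a0, fun _ _ => Iff.rfl⟩, ⟨a1, fun _ _ => Iff.rfl⟩,
      ⟨b4, fun _ _ => Iff.rfl⟩]

theorem charEquiv_snd_thd (j k : ℕ) :
    CharEquiv (mk p 0 (p ^ j) (p ^ k)) 0 ∨
      ∃ l, CharEquiv (mk p 0 (p ^ j) (p ^ k)) (rep p l) := by
  by_cases hjk : 2 ≤ j ∨ k ≤ j
  · refine CharEquiv.zero_or_rep_trans (h := mk p 0 0 (p ^ k)) ?_ (charEquiv_thd k)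
    rcases hjk with hj | hkj
    · rw [mk_snd_eq_zero hj]
      exact fun _ _ => Iff.rfl
    · obtain ⟨d, rfl⟩ := Nat.exists_eq_add_of_le hkj
      convert charEquiv_add_snd_thd (p := p) (-p ^ d) 0 (p ^ (k + d)) (p ^ k) using 2
      ring
  · obtain ⟨hj, hkj⟩ : j < 2 ∧ j < k := by omega
    right
    rcases le_or_gt (j + 2) k with hk | hk
    · have h : CharEquiv (mk p 0 (p ^ j) (p ^ k)) (mk p 0 (p ^ j) 0) := by
        obtain ⟨d, rfl⟩ := Nat.exists_eq_add_of_le hk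
        convert charEquiv_add_thd_snd (p := p) (-p ^ d) 0 (p ^ j) (p ^ (j + 2 + d)) using 2
        ring
      interval_cases j
      exacts [⟨b1, h⟩, ⟨b3, h⟩]
    · interval_cases j <;> interval_cases k
      exacts [⟨x01, fun _ _ => Iff.rfl⟩, ⟨x13, fun _ _ => Iff.rfl⟩]

theorem charEquiv_zero_or_rep (hp : p.Prime) (g : ZMod p × ZMod (p ^ 2) × ZMod (p ^ 4)) :
    CharEquiv g 0 ∨ ∃ l, CharEquiv g (rep p l) := by
  obtain ⟨x, y, z⟩ := g
  obtain ⟨u, i, hu, rfl⟩ := exists_eq_unit_mul_pow hp (pow_one p).symm x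
  obtain ⟨v, j, hv, rfl⟩ := exists_eq_unit_mul_pow hp rfl y
  obtain ⟨w, k, hw, rfl⟩ := exists_eq_unit_mul_pow hp rfl z
  refine CharEquiv.zero_or_rep_trans (g := mk p (u * p ^ i) (v * p ^ j) (w * p ^ k))
    (h := mk p (p ^ i) (p ^ j) (p ^ k))
    (((charEquiv_mul_fst hu _ _ _).trans (charEquiv_mul_snd hv _ _ _)).trans
      (charEquiv_mul_thd hw _ _ _)).symm ?_
  by_cases hijk : 1 ≤ i ∨ j = 0 ∨ k = 0
  · refine CharEquiv.zero_or_rep_trans ?_ (charEquiv_snd_thd j k)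
    rcases hijk with hi | rfl | rfl
    · rw [mk_fst_eq_zero hi]
      exact fun _ _ => Iff.rfl
    · convert charEquiv_add_fst_snd (p := p) (-p ^ i) (p ^ i) (p ^ 0) (p ^ k) using 2
      ring
    · convert charEquiv_add_fst_thd (p := p) (-p ^ i) (p ^ i) (p ^ j) (p ^ 0) using 2
      ring
  · obtain ⟨rfl, hj, hk⟩ : i = 0 ∧ 0 < j ∧ 0 < k := by omega
    have h : CharEquiv (mk p (p ^ 0) (p ^ j) (p ^ k)) (mk p (p ^ 0) 0 (p ^ k)) := by
      obtain ⟨d, rfl⟩ := Nat.exists_eq_add_of_lt hj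
      convert charEquiv_add_snd_fst (p := p) (-p ^ d) (p ^ 0) (p ^ (0 + d + 1)) (p ^ k) using 2
      ring
    right
    rcases le_or_gt 3 k with hk | hk
    · refine ⟨b2, h.trans ?_⟩
      obtain ⟨d, rfl⟩ := Nat.exists_eq_add_of_le hk
      convert charEquiv_add_thd_fst (p := p) (-p ^ d) (p ^ 0) 0 (p ^ (3 + d)) using 2
      rw [rep]
      congr 1
      ring
    · interval_cases k
      exacts [⟨x02, h⟩, ⟨x12, h⟩]

section

variable {H : AddSubgroup (ZMod p × ZMod (p ^ 2) × ZMod (p ^ 4))}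

theorem mul_thd_mem (hH : IsCharSub H) {l m n : ℤ} (h : mk p l m n ∈ H) :
    mk p 0 0 (p * n) ∈ H := by
  have := H.sub_mem h ((charEquiv_mul_thd (isCoprime_one_sub p) l m n H hH).1 h)
  rw [mk_sub] at this
  convert this using 2 <;> ring

theorem thd_mem_of_ne_two (hH : IsCharSub H) (hp : p.Prime) (hp2 : p ≠ 2) {l m n : ℤ}
    (h : mk p l m n ∈ H) : mk p 0 0 n ∈ H := by
  have := H.sub_mem h ((charEquiv_mul_thd isCoprime_one_left.neg_left l m n H hH).1 h)
  rw [mk_sub] at this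
  refine (charEquiv_mul_thd (isCoprime_two_of_ne_two hp hp2) 0 0 n H hH).2 ?_
  convert this using 2 <;> ring

theorem fst_of_snd_mem (hH : IsCharSub H) {l m n : ℤ} (h : mk p l m n ∈ H) :
    mk p m 0 0 ∈ H := by
  have := H.sub_mem ((charEquiv_add_fst_snd 1 l m n H hH).1 h) h
  rw [mk_sub] at this
  convert this using 2 <;> ring

theorem snd_of_fst_mem (hH : IsCharSub H) {l m n : ℤ} (h : mk p l m n ∈ H) :
    mk p 0 (p * l) 0 ∈ H := by
  have := H.sub_mem ((charEquiv_add_snd_fst 1 l m n H hH).1 h) h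
  rw [mk_sub] at this
  convert this using 2 <;> ring

theorem snd_of_thd_mem (hH : IsCharSub H) {l m n : ℤ} (h : mk p l m n ∈ H) :
    mk p 0 n 0 ∈ H := by
  have := H.sub_mem ((charEquiv_add_snd_thd 1 l m n H hH).1 h) h
  rw [mk_sub] at this
  convert this using 2 <;> ring

theorem thd_of_snd_mem (hH : IsCharSub H) {l m n : ℤ} (h : mk p l m n ∈ H) :
    mk p 0 0 (p ^ 2 * m) ∈ H := by
  have := H.sub_mem ((charEquiv_add_thd_snd 1 l m n H hH).1 h) h
  rw [mk_sub] at this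
  convert this using 2 <;> ring

theorem fst_snd_mem_iff {l m n : ℤ} (h : mk p 0 0 n ∈ H) :
    mk p l m 0 ∈ H ↔ mk p l m n ∈ H := by
  rw [← H.add_mem_cancel_right h, mk_add, add_zero, add_zero, zero_add]

theorem thd_mem_iff {l m n : ℤ} (h : mk p l m 0 ∈ H) :
    mk p 0 0 n ∈ H ↔ mk p l m n ∈ H := by
  rw [← H.add_mem_cancel_left h, mk_add, add_zero, add_zero, zero_add]

theorem admissible (hp : p.Prime) (hH : IsCharSub H) :
    Admissible p (fun l => rep p l ∈ H) where
  a0_a1 h := by simpa only [rep, ← pow_succ'] using mul_thd_mem hH h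
  b0_b1 h := by simpa [rep] using snd_of_thd_mem hH h
  b1_b2 h := by simpa [rep] using fst_of_snd_mem hH h
  b2_b3 h := by simpa only [rep, ← pow_succ'] using snd_of_fst_mem hH h
  b3_b4 h := by simpa only [rep, ← pow_add] using thd_of_snd_mem hH h
  a0_b3 h := snd_of_thd_mem hH h
  a1_b4 h := by simpa only [rep, ← pow_succ'] using mul_thd_mem hH h
  b0_a0 h := by simpa only [rep, ← pow_succ'] using mul_thd_mem hH h
  b1_a1 h := by simpa only [rep, ← pow_add] using thd_of_snd_mem hH h
  x01_a1 h := by simpa only [rep, ← pow_succ'] using mul_thd_mem hH h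
  x01_b2 h := fst_of_snd_mem hH h
  x02_a1 h := by simpa only [rep, ← pow_succ'] using mul_thd_mem hH h
  x02_b3 h := by simpa only [rep, ← pow_succ'] using snd_of_fst_mem hH h
  x12_b3 h := by simpa only [rep, ← pow_succ'] using snd_of_fst_mem hH h
  x13_b4 h := by simpa only [rep, ← pow_succ'] using mul_thd_mem hH h
  a0_b1 h := fst_snd_mem_iff h
  a0_b2 h := fst_snd_mem_iff h
  a1_b2 h := fst_snd_mem_iff h
  a1_b3 h := fst_snd_mem_iff h
  b1_a0 h := thd_mem_iff h
  b2_a0 h := thd_mem_iff h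
  b2_a1 h := thd_mem_iff h
  b3_a1 h := thd_mem_iff h
  x01_x02 h h' := by
    have := H.sub_mem h h'
    rw [rep, rep, mk_sub] at this
    have := (charEquiv_add_fst_snd 1 _ _ _ H hH).1 this
    rw [rep]
    convert this using 2 <;> ring
  x02_x12 h h' := by
    have := H.sub_mem h h'
    rw [rep, rep, mk_sub] at this
    refine (charEquiv_mul_thd (isCoprime_one_sub p) _ _ _ H hH).2 ?_
    convert this using 2 <;> ring
  x12_x13 h h' := by
    have := H.sub_mem h h'
    rw [rep, rep, mk_sub] at this
    have := (charEquiv_add_snd_fst 1 _ _ _ H hH).1 this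
    rw [rep]
    convert this using 2 <;> ring
  x01_of_odd hp2 h := thd_mem_of_ne_two hH hp hp2 h
  x02_of_odd hp2 h := thd_mem_of_ne_two hH hp hp2 h
  x12_of_odd hp2 h := thd_mem_of_ne_two hH hp hp2 h
  x13_of_odd hp2 h := thd_mem_of_ne_two hH hp hp2 h

end

/-- The characteristic subgroup with parameters `(a, b)`. -/
def regularSubgroup (p a b : ℕ) : AddSubgroup (ZMod p × ZMod (p ^ 2) × ZMod (p ^ 4)) :=
  powerSubgroup _ p
    (if b ≤ 0 then 4 else if a ≤ 0 then 3 else if a ≤ 1 then 2 else if b ≤ 4 then 1 else 0)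
    (if b = 2 then 1 else 0)
    (if b ≤ 1 then 0 else if b = 3 then 1 else 2)

theorem mk_mem_powerSubgroup_iff (hp : p.Prime) (r s t : ℕ) (l m n : ℤ) :
    mk p l m n ∈ powerSubgroup (ZMod p × ZMod (p ^ 2) × ZMod (p ^ 4)) p r s t ↔
      ((p : ℤ) ^ (1 - r) ∣ l ∧ (p : ℤ) ^ (min t 1 - s) ∣ l) ∧
      ((p : ℤ) ^ (2 - r) ∣ m ∧ (p : ℤ) ^ (min t 2 - s) ∣ m) ∧
      ((p : ℤ) ^ (4 - r) ∣ n ∧ (p : ℤ) ^ (min t 4 - s) ∣ n) := by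
  rw [mk, mk_mem_powerSubgroup, mk_mem_powerSubgroup,
    intCast_mem_powerSubgroup hp (pow_one p).symm,
    intCast_mem_powerSubgroup hp rfl, intCast_mem_powerSubgroup hp rfl]

theorem rep_mem_regularSubgroup (hp : p.Prime) {a b : ℕ} (ha : a ≤ 2) (hab : a ≤ b)
    (hb : b ≤ a + 3) (l : OrbitLabel) : rep p l ∈ regularSubgroup p a b ↔ Regular a b l := by
  have h_dvd (i j : ℕ) : (p : ℤ) ^ i ∣ (p : ℤ) ^ j ↔ i ≤ j :=
    pow_dvd_pow_iff (by exact_mod_cast hp.ne_zero)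
      (by simpa [Int.isUnit_iff_natAbs_eq] using hp.ne_one)
  cases l <;> simp only [rep, regularSubgroup, mk_mem_powerSubgroup_iff hp, h_dvd, dvd_zero,
    and_true, true_and, Regular] <;> interval_cases a <;> interval_cases b <;> decide

theorem add_mem_regularSubgroup (hp : p = 2) {a b a' b' : ℕ} (ha : a ≤ 1) (hab : a < b)
    (hb : b < a + 3) (h' : a' = a + 1 ∧ b' = b ∨ a' = a ∧ b' = b + 1) :
    ∀ g ∈ regularSubgroup p a b, ∀ h ∈ regularSubgroup p a b,
      g ∉ regularSubgroup p a' b' → h ∉ regularSubgroup p a' b' →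
      g + h ∈ regularSubgroup p a' b' := by
  subst hp
  rintro ⟨x, y, z⟩ hg ⟨x', y', z'⟩ hh
  obtain ⟨l, rfl⟩ := ZMod.intCast_surjective x
  obtain ⟨m, rfl⟩ := ZMod.intCast_surjective y
  obtain ⟨n, rfl⟩ := ZMod.intCast_surjective z
  obtain ⟨l', rfl⟩ := ZMod.intCast_surjective x'
  obtain ⟨m', rfl⟩ := ZMod.intCast_surjective y'
  obtain ⟨n', rfl⟩ := ZMod.intCast_surjective z'
  change mk 2 l m n ∈ _ at hg
  change mk 2 l' m' n' ∈ _ at hh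
  change mk 2 l m n ∉ _ → mk 2 l' m' n' ∉ _ → mk 2 l m n + mk 2 l' m' n' ∈ _
  rw [mk_add]
  simp only [regularSubgroup, mk_mem_powerSubgroup_iff Nat.prime_two] at hg hh ⊢
  rcases h' with ⟨ha', hb'⟩ | ⟨ha', hb'⟩ <;>
    simp only [ha', hb'] <;> interval_cases a <;> interval_cases b <;>
    norm_num at hg hh ⊢ <;> omega

/-- The classification for `ℤ/p × ℤ/p² × ℤ/p⁴`. -/
def orbitClassification (hp : p.Prime) :
    OrbitClassification p (ZMod p × ZMod (p ^ 2) × ZMod (p ^ 4)) where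
  rep := rep p
  charEquiv_zero_or_rep := charEquiv_zero_or_rep hp
  admissible _ := admissible hp
  exists_of_admissible := exists_isCharSub_of_admissible (rep p) (regularSubgroup p)
    (fun _ _ => isCharSub_powerSubgroup _ _ _ _ _)
    (fun _ _ ha hab hb => rep_mem_regularSubgroup hp ha hab hb)
    (fun hp _ _ _ _ ha hab hb h => add_mem_regularSubgroup hp ha hab hb h)

end ThreeFactors

theorem stmt_14 (p : ℕ) (hp : p.Prime) :
    Nonempty ({H : AddSubgroup (ZMod (p ^ 2) × ZMod (p ^ 5)) // IsCharSub H} ≃o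
      {K : AddSubgroup (ZMod p × ZMod (p ^ 2) × ZMod (p ^ 4)) // IsCharSub K}) :=
  ⟨(TwoFactors.orbitClassification hp).orderIso.trans
    (ThreeFactors.orbitClassification hp).orderIso.symm⟩
end

section
/- Let G = Z_{2^{λ_1}} × ⋯ × Z_{2^{λ_n}} be an abelian 2-group. Then the lattice of characteristic subgroups of G is distributive — that is, A ∩ (B ⊔ C) = (A ∩ B) ⊔ (A ∩ C) for all characteristic subgroups A, B, C of G, where ⊔ is the subgroup join — if and only if every characteristic subgroup of G is regular. -/
/-- The regular subgroup `R(a)`: elements whose `i`-th component is killed by `p ^ a i`. -/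
def regSub (p : ℕ) {n : ℕ} (lam a : Fin n → ℕ) :
    AddSubgroup (Π i : Fin n, ZMod (p ^ lam i)) where
  carrier := {g | ∀ i, (p ^ a i : ℕ) • g i = 0}
  zero_mem' := by intro i; simp
  add_mem' := by
    intro x y hx hy i
    have : (p ^ a i : ℕ) • (x i + y i) = 0 := by
      rw [smul_add, hx i, hy i, add_zero]
    simpa using this
  neg_mem' := by
    intro x hx i
    have : (p ^ a i : ℕ) • (-x i) = 0 := by
      rw [smul_neg, hx i, neg_zero]
    simpa using this

/-- To be characteristic it suffices to be mapped into itself by every automorphism. -/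
theorem isCharSub_of_forall_mem {G : Type*} [AddGroup G] {H : AddSubgroup G}
    (h : ∀ (φ : AddAut G), ∀ x ∈ H, φ x ∈ H) : IsCharSub H := by
  intro φ
  apply le_antisymm
  · rintro _ ⟨x, hx, rfl⟩
    exact h φ x hx
  · intro x hx
    exact ⟨φ.symm x, h φ.symm x hx, φ.apply_symm_apply x⟩

theorem IsCharSub.apply_mem {G : Type*} [AddGroup G] {H : AddSubgroup G} (hH : IsCharSub H)
    (e : G ≃+ G) {x : G} (hx : x ∈ H) : e x ∈ H := by
  have h := hH e
  rw [← h]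
  exact ⟨x, hx, rfl⟩

section Pi

variable {ι : Type*} [DecidableEq ι] {M : ι → Type*} [∀ i, AddCommGroup (M i)]

/-- The automorphism adding the image of the `i`-th coordinate under `f` to the `j`-th one. -/
def piTransvection {i j : ι} (hij : i ≠ j) (f : M i →+ M j) : (Π i, M i) ≃+ (Π i, M i) where
  toFun x := x + Pi.single j (f (x i))
  invFun x := x - Pi.single j (f (x i))
  left_inv x := by simp [hij]
  right_inv x := by simp [hij]
  map_add' x y := by
    simp only [Pi.add_apply, map_add, Pi.single_add]
    abel

/-- The automorphism negating the `i`-th coordinate. -/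
def piNegCoord (i : ι) : (Π i, M i) ≃+ (Π i, M i) where
  toFun x := x - Pi.single i (2 • x i)
  invFun x := x - Pi.single i (2 • x i)
  left_inv x := by
    simp only [Pi.sub_apply, Pi.single_eq_same, sub_sub, ← Pi.single_add]
    rw [show 2 • x i + 2 • (x i - 2 • x i) = 0 by abel]
    simp
  right_inv x := by
    simp only [Pi.sub_apply, Pi.single_eq_same, sub_sub, ← Pi.single_add]
    rw [show 2 • x i + 2 • (x i - 2 • x i) = 0 by abel]
    simp
  map_add' x y := by
    simp only [Pi.add_apply, smul_add, Pi.single_add]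
    abel

variable {H : AddSubgroup (Π i, M i)}

theorem IsCharSub.single_hom_mem (hH : IsCharSub H) {i j : ι} (hij : i ≠ j) (f : M i →+ M j)
    {h : Π i, M i} (hh : h ∈ H) : Pi.single j (f (h i)) ∈ H := by
  have := H.sub_mem (hH.apply_mem (piTransvection hij f) hh) hh
  simpa [piTransvection] using this

theorem IsCharSub.single_two_nsmul_mem (hH : IsCharSub H) (i : ι)
    {h : Π i, M i} (hh : h ∈ H) : Pi.single i (2 • h i) ∈ H := by
  have := H.sub_mem hh (hH.apply_mem (piNegCoord i) hh)
  simpa [piNegCoord] using this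

theorem IsCharSub.single_mem_of_addEquiv (hH : IsCharSub H) {i j : ι} (hij : i ≠ j)
    (e : M i ≃+ M j) {h : Π i, M i} (hh : h ∈ H) : Pi.single i (h i) ∈ H := by
  have h1 := hH.single_hom_mem hij e.toAddMonoidHom hh
  simpa using hH.single_hom_mem hij.symm e.symm.toAddMonoidHom h1

end Pi

theorem ZMod.addMonoidHom_apply_eq {N : ℕ} [NeZero N] {A : Type*} [AddCommGroup A]
    (f : ZMod N →+ A) (x : ZMod N) : f x = x.val • f 1 := by
  rw [← map_nsmul]
  simp

/-- A subgroup of `ZMod (p ^ l)` is the kernel of multiplication by a power of `p`. -/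
theorem ZMod.exists_mem_iff_pow_nsmul_eq_zero {p : ℕ} (hp : p.Prime) (l : ℕ)
    (K : AddSubgroup (ZMod (p ^ l))) :
    ∃ a ≤ l, ∀ x, x ∈ K ↔ (p ^ a : ℕ) • x = 0 := by
  have : NeZero (p ^ l) := ⟨pow_ne_zero _ hp.ne_zero⟩
  have hd : Nat.card K ∣ p ^ l := by
    simpa using AddSubgroup.card_addSubgroup_dvd_card K
  obtain ⟨a, ha, hc⟩ := (Nat.dvd_prime_pow hp).1 hd
  refine ⟨a, ha, ?_⟩
  have hle : (K : Set (ZMod (p ^ l))).toFinite.toFinset ⊆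
      Finset.univ.filter fun x : ZMod (p ^ l) => (p ^ a : ℕ) • x = 0 := by
    intro x hx
    have hx : x ∈ K := by simpa using hx
    rw [Finset.mem_filter]
    refine ⟨Finset.mem_univ _, ?_⟩
    have := card_nsmul_eq_zero' (x := (⟨x, hx⟩ : K))
    rw [hc] at this
    simpa using congrArg Subtype.val this
  have heq := Finset.eq_of_subset_of_card_le hle (by
    refine (IsAddCyclic.card_nsmul_eq_zero_le (pow_pos hp.pos a)).trans ?_
    rw [← hc, ← Nat.card_eq_card_finite_toFinset]
    rfl)
  intro x
  have := Finset.ext_iff.1 heq x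
  simpa using this

section TwoGroup

variable {n : ℕ} {lam : Fin n → ℕ}

/-- The diagonal coefficient of an automorphism at a summand whose order occurs only once
is odd. -/
theorem odd_val_addAut_single (φ : AddAut (Π i : Fin n, ZMod (2 ^ lam i))) {j : Fin n}
    (hpos : 1 ≤ lam j) (hj : ∀ i, i ≠ j → lam i ≠ lam j) :
    Odd (φ (Pi.single j 1) j).val := by
  by_contra hodd
  rw [Nat.not_odd_iff_even] at hodd
  have hN : (2 ^ lam j : ℕ) = 2 ^ (lam j - 1) * 2 := by
    rw [← pow_succ, Nat.sub_add_cancel hpos]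
  have hdiv : ∀ i, ∃ z : ZMod (2 ^ lam i),
      (2 ^ (lam j - 1) : ℕ) • φ (Pi.single j 1) i = (2 ^ lam j : ℕ) • z := by
    intro i
    have key : 2 ∣ (φ (Pi.single j 1) i).val → ∃ z : ZMod (2 ^ lam i),
        (2 ^ (lam j - 1) : ℕ) • φ (Pi.single j 1) i = (2 ^ lam j : ℕ) • z := by
      rintro ⟨m, hm⟩
      refine ⟨(m : ZMod (2 ^ lam i)), ?_⟩
      rw [← ZMod.natCast_zmod_val (φ (Pi.single j 1) i), hm, mul_comm 2 m]
      have hN' := congrArg (Nat.cast : ℕ → ZMod (2 ^ lam i)) hN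
      simp only [nsmul_eq_mul]
      rw [hN']
      push_cast
      ring
    rcases lt_trichotomy (lam i) (lam j) with h | h | h
    · refine ⟨0, ?_⟩
      have h0 : ((2 ^ (lam j - 1) : ℕ) : ZMod (2 ^ lam i)) = 0 :=
        (ZMod.natCast_eq_zero_iff _ _).2 (pow_dvd_pow 2 (by omega))
      rw [nsmul_eq_mul, h0]
      simp
    · have hij : i = j := by
        by_contra hij
        exact hj i hij h
      subst hij
      exact key hodd.two_dvd
    · apply key
      have h0 : (2 ^ lam j : ℕ) • φ (Pi.single j 1) i = 0 := by
        rw [← Pi.smul_apply, ← map_nsmul, ← Pi.single_smul, nsmul_eq_mul, ZMod.natCast_self]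
        simp
      rw [← ZMod.natCast_zmod_val (φ (Pi.single j 1) i), nsmul_eq_mul, ← Nat.cast_mul,
        ZMod.natCast_eq_zero_iff] at h0
      have h1 : 2 ^ lam j * 2 ∣ 2 ^ lam j * (φ (Pi.single j 1) i).val :=
        (by rw [← pow_succ]; exact pow_dvd_pow 2 h : 2 ^ lam j * 2 ∣ 2 ^ lam i).trans h0
      exact Nat.dvd_of_mul_dvd_mul_left (by positivity) h1
  choose z hz using hdiv
  have h1 : φ ((2 ^ (lam j - 1) : ℕ) • Pi.single j 1) = (2 ^ lam j : ℕ) • z := by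
    rw [map_nsmul]
    exact funext hz
  have h2 : (2 ^ (lam j - 1) : ℕ) • (Pi.single j 1 : Π i : Fin n, ZMod (2 ^ lam i)) =
      (2 ^ lam j : ℕ) • φ.symm z := by
    rw [← map_nsmul, ← h1, AddEquiv.symm_apply_apply]
  have h3 := congrFun h2 j
  simp only [Pi.smul_apply, Pi.single_eq_same] at h3
  rw [nsmul_eq_mul, nsmul_eq_mul, ZMod.natCast_self, zero_mul, mul_one,
    ZMod.natCast_eq_zero_iff, Nat.pow_dvd_pow_iff_le_right (by norm_num)] at h3
  omega

variable {H : AddSubgroup (Π i : Fin n, ZMod (2 ^ lam i))}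

/-- Automorphisms act trivially on the projections of `H` modulo the coordinate parts of `H`. -/
theorem IsCharSub.single_addAut_sub_mem (hlam : ∀ i, 1 ≤ lam i) (hH : IsCharSub H)
    (φ : AddAut (Π i : Fin n, ZMod (2 ^ lam i))) {u : Π i : Fin n, ZMod (2 ^ lam i)}
    (hu : ∀ i, ∃ h ∈ H, h i = u i) (j : Fin n) :
    Pi.single j ((φ u - u) j) ∈ H := by
  have hsum : (φ u - u) j = ∑ i,
      (φ (Pi.single i (u i)) j - (Pi.single i (u i) : Π i : Fin n, ZMod (2 ^ lam i)) j) := by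
    conv_lhs => rw [← Finset.univ_sum_single u]
    rw [map_sum]
    simp only [Pi.sub_apply, Finset.sum_apply, Finset.sum_sub_distrib]
  rw [hsum, ← AddMonoidHom.single_apply, map_sum]
  refine H.sum_mem fun i _ => ?_
  rw [AddMonoidHom.single_apply]
  obtain ⟨h, hh, hi⟩ := hu i
  rw [← hi]
  by_cases hij : i = j
  · subst hij
    by_cases hrep : ∃ k, k ≠ i ∧ lam k = lam i
    · obtain ⟨k, hki, hk⟩ := hrep
      let e : ZMod (2 ^ lam i) ≃+ ZMod (2 ^ lam k) :=
        (ZMod.ringEquivCongr (by rw [hk])).toAddEquiv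
      have h1 : Pi.single i (h i) ∈ H := hH.single_mem_of_addEquiv hki.symm e hh
      have h2 := hH.single_mem_of_addEquiv hki.symm e (hH.apply_mem φ h1)
      rw [Pi.single_eq_same, Pi.single_sub]
      exact H.sub_mem h2 h1
    · push Not at hrep
      obtain ⟨m, hm⟩ := odd_val_addAut_single φ (hlam i) hrep
      have hc : φ (Pi.single i (h i)) i = (h i).val • φ (Pi.single i 1) i :=
        ZMod.addMonoidHom_apply_eq ((Pi.evalAddMonoidHom _ i).comp
          (φ.toAddMonoidHom.comp (AddMonoidHom.single _ i))) (h i)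
      have hd : φ (Pi.single i (h i)) i - h i = 2 • (m • h) i := by
        rw [hc, ← ZMod.natCast_zmod_val (φ (Pi.single i 1) i), hm]
        simp only [nsmul_eq_mul, Pi.smul_apply, ZMod.natCast_val, ZMod.cast_id', id]
        push_cast
        ring
      rw [Pi.single_eq_same, hd]
      exact hH.single_two_nsmul_mem i (H.nsmul_mem hh m)
  · rw [Pi.single_eq_of_ne (Ne.symm hij), sub_zero]
    exact hH.single_hom_mem hij ((Pi.evalAddMonoidHom _ j).comp
      (φ.toAddMonoidHom.comp (AddMonoidHom.single _ i))) hh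

/-- The elements whose coordinates in `S` lie in the projections of `H` and whose other
coordinates lie in the coordinate parts of `H`. -/
def coordHull (H : AddSubgroup (Π i : Fin n, ZMod (2 ^ lam i))) (S : Set (Fin n)) :
    AddSubgroup (Π i : Fin n, ZMod (2 ^ lam i)) where
  carrier := {u | (∀ i, ∃ h ∈ H, h i = u i) ∧ ∀ i ∉ S, Pi.single i (u i) ∈ H}
  zero_mem' := ⟨fun _ => ⟨0, H.zero_mem, rfl⟩, fun i _ => by simp⟩
  add_mem' := by
    rintro x y ⟨hx, hx'⟩ ⟨hy, hy'⟩
    refine ⟨fun i => ?_, fun i hi => ?_⟩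
    · obtain ⟨h, hh, h1⟩ := hx i
      obtain ⟨k, hk, h2⟩ := hy i
      exact ⟨h + k, H.add_mem hh hk, by simp [h1, h2]⟩
    · rw [Pi.add_apply, Pi.single_add]
      exact H.add_mem (hx' i hi) (hy' i hi)
  neg_mem' := by
    rintro x ⟨hx, hx'⟩
    refine ⟨fun i => ?_, fun i hi => ?_⟩
    · obtain ⟨h, hh, h1⟩ := hx i
      exact ⟨-h, H.neg_mem hh, by simp [h1]⟩
    · rw [Pi.neg_apply, Pi.single_neg]
      exact H.neg_mem (hx' i hi)

theorem IsCharSub.coordHull (hlam : ∀ i, 1 ≤ lam i) (hH : IsCharSub H) (S : Set (Fin n)) :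
    IsCharSub (coordHull H S) := by
  refine isCharSub_of_forall_mem fun φ u hu => ?_
  have hd := hH.single_addAut_sub_mem hlam φ hu.1
  have hmem : φ u - u ∈ _root_.coordHull H S :=
    ⟨fun i => ⟨_, hd i, Pi.single_eq_same _ _⟩, fun i _ => hd i⟩
  simpa using AddSubgroup.add_mem _ hmem hu

/-- If characteristic subgroups distribute, each of them contains its projections to the
coordinate axes. -/
theorem single_mem_of_distrib (hlam : ∀ i, 1 ≤ lam i)
    (hdist : ∀ A B C : AddSubgroup (Π i : Fin n, ZMod (2 ^ lam i)),
      IsCharSub A → IsCharSub B → IsCharSub C → A ⊓ (B ⊔ C) = (A ⊓ B) ⊔ (A ⊓ C))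
    (hH : IsCharSub H) (t : Fin n) {h : Π i : Fin n, ZMod (2 ^ lam i)} (hh : h ∈ H) :
    Pi.single t (h t) ∈ H := by
  have hmem : h ∈ H ⊓ (coordHull H {t} ⊔ coordHull H {t}ᶜ) := by
    refine ⟨hh, ?_⟩
    refine AddSubgroup.mem_sup.2
      ⟨Pi.single t (h t), ⟨fun i => ?_, fun i hi => ?_⟩,
        h - Pi.single t (h t), ⟨fun i => ?_, fun i hi => ?_⟩, by abel⟩
    · by_cases hi : i = t
      · subst hi
        exact ⟨h, hh, by simp⟩
      · exact ⟨0, H.zero_mem, by simp [hi]⟩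
    · have hi : i ≠ t := hi
      simp [hi]
    · by_cases hi : i = t
      · subst hi
        exact ⟨0, H.zero_mem, by simp⟩
      · exact ⟨h, hh, by simp [hi]⟩
    · have hi : i = t := by simpa using hi
      subst hi
      simp
  rw [hdist _ _ _ hH (hH.coordHull hlam _) (hH.coordHull hlam _), AddSubgroup.mem_sup] at hmem
  obtain ⟨y, ⟨hyH, hy⟩, z, ⟨hzH, hz⟩, rfl⟩ := hmem
  rw [Pi.add_apply, Pi.single_add]
  refine H.add_mem ?_ (hz.2 t (by simp))
  have hsum : Pi.single t (y t) = y - ∑ i ∈ Finset.univ.erase t, Pi.single i (y i) := by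
    rw [eq_sub_iff_add_eq, Finset.add_sum_erase _ (fun i => Pi.single i (y i)) (Finset.mem_univ t),
      Finset.univ_sum_single]
  rw [hsum]
  exact H.sub_mem hyH (H.sum_mem fun i hi => hy.2 i (Finset.ne_of_mem_erase hi))

end TwoGroup

theorem eq_regSub_of_single_mem {p n : ℕ} (hp : p.Prime) {lam : Fin n → ℕ}
    {H : AddSubgroup (Π i : Fin n, ZMod (p ^ lam i))}
    (hH : ∀ h ∈ H, ∀ i, Pi.single i (h i) ∈ H) :
    ∃ a : Fin n → ℕ, (∀ i, a i ≤ lam i) ∧ H = regSub p lam a := by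
  choose a ha hmem using fun i => ZMod.exists_mem_iff_pow_nsmul_eq_zero hp (lam i)
    (H.comap (AddMonoidHom.single (fun i => ZMod (p ^ lam i)) i))
  refine ⟨a, ha, AddSubgroup.ext fun h =>
    ⟨fun hh i => (hmem i (h i)).1 (hH h hh i), fun hh => ?_⟩⟩
  rw [← Finset.univ_sum_single h]
  exact H.sum_mem fun i _ => (hmem i (h i)).2 (hh i)

theorem pow_nsmul_eq_zero_of_le {A : Type*} [AddMonoid A] {p a b : ℕ} (hab : a ≤ b) {x : A}
    (hx : p ^ a • x = 0) : p ^ b • x = 0 := by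
  obtain ⟨c, hc⟩ := pow_dvd_pow p hab
  rw [hc, mul_nsmul, hx, nsmul_zero]

theorem regSub_inf_sup (p : ℕ) {n : ℕ} (lam a b c : Fin n → ℕ) :
    regSub p lam a ⊓ (regSub p lam b ⊔ regSub p lam c) =
      (regSub p lam a ⊓ regSub p lam b) ⊔ (regSub p lam a ⊓ regSub p lam c) := by
  refine le_antisymm ?_ le_inf_sup
  rintro x ⟨hxa, hx⟩
  obtain ⟨y, hy, z, hz, rfl⟩ := AddSubgroup.mem_sup.1 hx
  rw [AddSubgroup.mem_sup]
  refine ⟨fun i => if c i ≤ b i then (y + z) i else 0, ⟨fun i => ?_, fun i => ?_⟩,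
    fun i => if c i ≤ b i then 0 else (y + z) i, ⟨fun i => ?_, fun i => ?_⟩, ?_⟩
  · by_cases h : c i ≤ b i
    · simpa only [if_pos h] using hxa i
    · simp only [if_neg h, smul_zero]
  · by_cases h : c i ≤ b i
    · simp only [if_pos h, Pi.add_apply, smul_add, hy i, pow_nsmul_eq_zero_of_le h (hz i), add_zero]
    · simp only [if_neg h, smul_zero]
  · by_cases h : c i ≤ b i
    · simp only [if_pos h, smul_zero]
    · simpa only [if_neg h] using hxa i
  · by_cases h : c i ≤ b i
    · simp only [if_pos h, smul_zero]
    · simp only [if_neg h, Pi.add_apply, smul_add, hz i,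
        pow_nsmul_eq_zero_of_le (not_le.1 h).le (hy i), add_zero]
  · funext i
    by_cases h : c i ≤ b i <;> simp [h]

theorem stmt_15 (n : ℕ) (hn : 0 < n) (lam : Fin n → ℕ)
    (hlam1 : ∀ i, 1 ≤ lam i) (hlam : Monotone lam) :
    (∀ A B C : AddSubgroup (Π i : Fin n, ZMod (2 ^ lam i)),
      IsCharSub A → IsCharSub B → IsCharSub C →
      A ⊓ (B ⊔ C) = (A ⊓ B) ⊔ (A ⊓ C)) ↔
    (∀ H : AddSubgroup (Π i : Fin n, ZMod (2 ^ lam i)), IsCharSub H →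
      ∃ a : Fin n → ℕ, (∀ i, a i ≤ lam i) ∧ H = regSub 2 lam a) := by
  constructor
  · intro hdist H hH
    exact eq_regSub_of_single_mem Nat.prime_two fun h hh i =>
      single_mem_of_distrib hlam1 hdist hH i hh
  · intro hreg A B C hA hB hC
    obtain ⟨a, -, rfl⟩ := hreg A hA
    obtain ⟨b, -, rfl⟩ := hreg B hB
    obtain ⟨c, -, rfl⟩ := hreg C hC
    exact regSub_inf_sup 2 lam a b c
end

section
/- Let p be a prime and G a nontrivial finite abelian p-group. Then G has a unique minimal nontrivial characteristic subgroup; that is, there exists a characteristic subgroup H of G with H ≠ {1} such that H ⊆ K for every characteristic subgroup K of G with K ≠ {1}. -/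
/-- An element outside the cyclic subgroup generated by an element `g` of maximal order is detected
by an endomorphism that kills `g` and takes values in that subgroup. -/
lemma exists_addMonoidHom_zmultiples_ne_zero {G : Type*} [AddCommGroup G] [Finite G] {g x : G}
    (hg : addOrderOf g = AddMonoid.exponent G) (hx : x ∉ AddSubgroup.zmultiples g) :
    ∃ f : G →+ G, f g = 0 ∧ f x ≠ 0 ∧ ∀ y, f y ∈ AddSubgroup.zmultiples g := by
  let Q := G ⧸ AddSubgroup.zmultiples g
  let N := AddMonoid.exponent G
  have : NeZero N := ⟨AddMonoid.exponent_ne_zero_of_finite⟩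
  have hx' : Multiplicative.ofAdd (x : Q) ≠ 1 := fun h =>
    hx ((QuotientAddGroup.eq_zero_iff x).1 (Multiplicative.ofAdd.injective h))
  have : NeZero (Monoid.exponent (Multiplicative Q)) := ⟨Monoid.exponent_ne_zero_of_finite⟩
  obtain ⟨χ, hχ⟩ := CommGroup.exists_apply_ne_one_of_hasEnoughRootsOfUnity
    (Multiplicative Q) ℂ hx'
  let χG : Multiplicative G →* ℂˣ := χ.comp (QuotientAddGroup.mk' _).toMultiplicative
  have hχN : ∀ y, χG y ∈ rootsOfUnity N ℂ := fun y => by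
    rw [mem_rootsOfUnity, ← map_pow]
    have : y ^ N = 1 := AddMonoid.exponent_nsmul_eq_zero (G := G) y.toAdd
    rw [this, map_one]
  have hcard : Nat.card (rootsOfUnity N ℂ) =
      Nat.card (Multiplicative (AddSubgroup.zmultiples g)) := by
    rw [HasEnoughRootsOfUnity.natCard_rootsOfUnity]
    exact hg.symm.trans (Nat.card_zmultiples g).symm
  let e : rootsOfUnity N ℂ ≃* Multiplicative (AddSubgroup.zmultiples g) :=
    mulEquivOfCyclicCardEq hcard
  let ψ : G →+ AddSubgroup.zmultiples g :=
    MonoidHom.toAdditive (e.toMonoidHom.comp (χG.codRestrict _ hχN))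
  have hψ : ∀ y : G, ψ y = 0 ↔ χ (Multiplicative.ofAdd (y : Q)) = 1 := fun y =>
    (map_eq_one_iff e e.injective).trans Subtype.ext_iff
  refine ⟨(AddSubgroup.subtype _).comp ψ, ?_, ?_, fun y => (ψ y).2⟩
  · have : ((g : G) : Q) = 0 :=
      (QuotientAddGroup.eq_zero_iff g).2 (AddSubgroup.mem_zmultiples g)
    have h0 : ψ g = 0 := (hψ g).2 (by rw [this]; exact map_one χ)
    simp [h0]
  · intro h
    exact hχ ((hψ x).1 (Subtype.ext h))

/-- An endomorphism of square zero maps a characteristic subgroup into itself. -/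
lemma IsCharSub.apply_mem_of_sq_eq_zero {G : Type*} [AddCommGroup G] {K : AddSubgroup G}
    (hK : IsCharSub K) (f : G →+ G) (hf : ∀ y, f (f y) = 0) {x : G} (hx : x ∈ K) : f x ∈ K := by
  let φ : AddAut G :=
    { toFun := fun y => y + f y
      invFun := fun y => y - f y
      left_inv := fun y => by simp [hf]
      right_inv := fun y => by simp [hf]
      map_add' := fun y z => by rw [map_add]; abel }
  have h : x + f x ∈ K := by
    rw [← hK φ]
    exact ⟨x, hx, rfl⟩
  exact (K.add_mem_cancel_left hx).1 h

/-- A nontrivial characteristic subgroup meets every cyclic subgroup of maximal order. -/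
lemma IsCharSub.exists_zsmul_mem_ne_zero {G : Type*} [AddCommGroup G] [Finite G]
    {K : AddSubgroup G} (hK : IsCharSub K) (hK0 : K ≠ ⊥) {g : G}
    (hg : addOrderOf g = AddMonoid.exponent G) : ∃ m : ℤ, m • g ∈ K ∧ m • g ≠ 0 := by
  obtain ⟨x, hxK, hx0⟩ := K.bot_or_exists_ne_zero.resolve_left hK0
  by_cases hx : x ∈ AddSubgroup.zmultiples g
  · obtain ⟨m, hm⟩ := AddSubgroup.mem_zmultiples_iff.1 hx
    exact ⟨m, hm ▸ hxK, hm ▸ hx0⟩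
  · obtain ⟨f, hfg, hfx, hf⟩ := exists_addMonoidHom_zmultiples_ne_zero hg hx
    have hsq : ∀ y, f (f y) = 0 := fun y => by
      obtain ⟨m, hm⟩ := AddSubgroup.mem_zmultiples_iff.1 (hf y)
      rw [← hm, map_zsmul, hfg, smul_zero]
    obtain ⟨m, hm⟩ := AddSubgroup.mem_zmultiples_iff.1 (hf x)
    exact ⟨m, hm ▸ hK.apply_mem_of_sq_eq_zero f hsq hxK, hm ▸ hfx⟩

/-- In a cyclic group of order `p ^ (n + 1)`, every nontrivial subgroup contains the multiples
of `p ^ n`. -/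
lemma AddSubgroup.prime_pow_nsmul_mem_of_zsmul_mem {G : Type*} [AddCommGroup G] {p n : ℕ}
    (hp : p.Prime) {g : G} (hg : addOrderOf g = p ^ (n + 1)) {K : AddSubgroup G} {m : ℤ}
    (hm : m • g ∈ K) (hm0 : m • g ≠ 0) : p ^ n • g ∈ K := by
  obtain ⟨a, ha, hgcd⟩ := (Nat.dvd_prime_pow hp).1 (Nat.gcd_dvd_right m.natAbs (p ^ (n + 1)))
  have han : a ≤ n := by
    by_contra h
    obtain rfl : a = n + 1 := by omega
    refine hm0 (addOrderOf_dvd_iff_zsmul_eq_zero.1 ?_)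
    rw [hg, Int.natCast_dvd, ← hgcd]
    exact Nat.gcd_dvd_left _ _
  have hmem : p ^ a • g ∈ K := by
    have hbez := Int.gcd_eq_gcd_ab m (p ^ (n + 1) : ℕ)
    have hgcd' : Int.gcd m (p ^ (n + 1) : ℕ) = p ^ a := by rw [← hgcd, Int.gcd, Int.natAbs_natCast]
    rw [hgcd'] at hbez
    rw [← natCast_zsmul, hbez, add_zsmul, mul_comm, mul_zsmul,
      mul_comm ((p ^ (n + 1) : ℕ) : ℤ), mul_zsmul, natCast_zsmul, ← hg, addOrderOf_nsmul_eq_zero,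
      smul_zero, add_zero]
    exact K.zsmul_mem hm _
  rw [← Nat.sub_add_cancel han, pow_add, mul_nsmul']
  exact K.nsmul_mem hmem _

/-- The subgroup of multiples of a fixed natural number is characteristic. -/
lemma isCharSub_range_nsmulAddMonoidHom {G : Type*} [AddCommGroup G] (n : ℕ) :
    IsCharSub (nsmulAddMonoidHom (α := G) n).range := by
  intro φ
  ext y
  constructor
  · rintro ⟨_, ⟨z, rfl⟩, rfl⟩
    exact ⟨φ z, (map_nsmul φ n z).symm⟩
  · rintro ⟨z, rfl⟩
    refine ⟨n • φ.symm z, ⟨φ.symm z, rfl⟩, ?_⟩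
    exact (map_nsmul φ n _).trans (congrArg _ (φ.apply_symm_apply z))

theorem stmt_17 (p : ℕ) (hp : p.Prime) (G : Type*) [AddCommGroup G] [Finite G]
    [Nontrivial G] (hG : ∃ k : ℕ, Nat.card G = p ^ k) :
    ∃ H : AddSubgroup G, IsCharSub H ∧ H ≠ ⊥ ∧
      ∀ K : AddSubgroup G, IsCharSub K → K ≠ ⊥ → H ≤ K := by
  obtain ⟨k, hk⟩ := hG
  obtain ⟨e, -, he⟩ := (Nat.dvd_prime_pow hp).1 (hk ▸ AddGroup.exponent_dvd_nat_card (G := G))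
  obtain ⟨n, rfl⟩ : ∃ n, e = n + 1 := Nat.exists_eq_succ_of_ne_zero fun h => by
    subst h
    exact not_subsingleton G (AddMonoid.exp_eq_one_iff.1 he)
  refine ⟨(nsmulAddMonoidHom (p ^ n)).range, isCharSub_range_nsmulAddMonoidHom _, ?_, ?_⟩
  · intro h
    have hdvd : p ^ (n + 1) ∣ p ^ n := he ▸ AddMonoid.exponent_dvd_of_forall_nsmul_eq_zero
      fun g => (AddSubgroup.mem_bot).1 (h ▸ ⟨g, rfl⟩)
    have := (Nat.pow_dvd_pow_iff_le_right hp.one_lt).1 hdvd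
    omega
  · rintro K hK hK0 _ ⟨g, rfl⟩
    change p ^ n • g ∈ K
    by_cases h0 : p ^ n • g = 0
    · exact h0 ▸ K.zero_mem
    have : Fact p.Prime := ⟨hp⟩
    have hg : addOrderOf g = p ^ (n + 1) := addOrderOf_eq_prime_pow h0
      (he ▸ AddMonoid.exponent_nsmul_eq_zero g)
    obtain ⟨m, hm, hm0⟩ := hK.exists_zsmul_mem_ne_zero hK0 (hg.trans he.symm)
    exact AddSubgroup.prime_pow_nsmul_mem_of_zsmul_mem hp hg hm hm0
end
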